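/- arXiv:2409.15405 — 5 statements merged into one kernel-verified Lean document; each statement's English description precedes it below -/
import Mathlib

section
/- For every x > 0 and every β ∈ ℝ, the equation y³ + β·y = x has a unique solution y > 0. Moreover, there exist absolute constants c > 0 and C > 0 such that for all x > 0 and all β ∈ ℝ, this unique positive solution y satisfies c·(√(max{0, −β}) + x/(x^{2/3} + |β|)) ≤ y ≤ C·(√(max{0, −β}) + x/(x^{2/3} + |β|)). -/
/-- The cubic `y³ + βy` takes every positive value exactly once on the positive half-line. -/
theorem existsUnique_pos_cubic_eq {x : ℝ} (β : ℝ) (hx : 0 < x) :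
    ∃! y : ℝ, 0 < y ∧ y ^ 3 + β * y = x := by
  have hβ := neg_abs_le β
  have hb := abs_nonneg β
  have hivt := intermediate_value_Icc (a := 0) (b := 1 + |β| + x) (by positivity)
    (f := fun y : ℝ => y ^ 3 + β * y) (by fun_prop)
  have hM : x ≤ (1 + |β| + x) ^ 3 + β * (1 + |β| + x) := by
    have h : 1 ≤ (1 + |β| + x) ^ 2 + β := by nlinarith [mul_nonneg hb hx.le]
    nlinarith
  obtain ⟨y, ⟨hy0, -⟩, hy⟩ := hivt (show x ∈ _ from ⟨by simpa using hx.le, hM⟩)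
  replace hy : y ^ 3 + β * y = x := hy
  have hypos : 0 < y := by
    refine hy0.lt_of_ne ?_
    rintro rfl
    simp at hy
    exact hx.ne hy
  refine ⟨y, ⟨hypos, hy⟩, ?_⟩
  rintro z ⟨hz, hzx⟩
  have hzβ : 0 < z ^ 2 + β := pos_of_mul_pos_right (a := z) (by nlinarith) hz.le
  have hfac : (z - y) * ((z ^ 2 + β) + z * y + y ^ 2) = 0 := by linear_combination hzx - hy
  rcases mul_eq_zero.mp hfac with h | h
  · linarith
  · nlinarith [mul_pos hz hypos]

/-- Two-sided bound for a positive root of `y³ + by = t³` with `b ≥ 0`. -/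
theorem cubic_root_bounds_of_nonneg {t b y : ℝ} (ht : 0 < t) (hb : 0 ≤ b) (hy : 0 < y)
    (h : y ^ 3 + b * y = t ^ 3) :
    t ^ 3 / (t ^ 2 + b) ≤ y ∧ y ≤ 2 * (t ^ 3 / (t ^ 2 + b)) := by
  have hyt : y ≤ t := by
    have := mul_nonneg hb hy.le
    exact le_of_pow_le_pow_left₀ three_ne_zero ht.le (by linarith)
  have hpos : 0 < t ^ 2 + b := by positivity
  constructor
  · rw [div_le_iff₀ hpos]
    nlinarith [mul_le_mul_of_nonneg_left (pow_le_pow_left₀ hy.le hyt 2) hy.le]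
  · rw [← mul_div_assoc, le_div_iff₀ hpos]
    nlinarith [mul_le_mul_of_nonneg_right hyt (sq_nonneg t), pow_pos hy 3]

/-- Two-sided bound for a positive root of `y³ - s²y = t³`. -/
theorem cubic_root_bounds_of_neg {t s y : ℝ} (ht : 0 < t) (hs : 0 ≤ s) (hy : 0 < y)
    (h : y ^ 3 - s ^ 2 * y = t ^ 3) :
    s + t ^ 3 / (t ^ 2 + s ^ 2) ≤ 2 * y ∧ y ≤ 4 * (s + t ^ 3 / (t ^ 2 + s ^ 2)) := by
  have hpos : 0 < t ^ 2 + s ^ 2 := by positivity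
  have ht3 : 0 < t ^ 3 := by positivity
  have hq : 0 ≤ t ^ 3 / (t ^ 2 + s ^ 2) := by positivity
  constructor
  · have hty : t ≤ y :=
      le_of_pow_le_pow_left₀ three_ne_zero hy.le (by nlinarith [mul_nonneg (sq_nonneg s) hy.le])
    have hsy : s ≤ y := by
      have : 0 < y ^ 2 - s ^ 2 := pos_of_mul_pos_right (a := y) (by nlinarith) hy.le
      exact le_of_pow_le_pow_left₀ two_ne_zero hy.le (by linarith)
    have hqt : t ^ 3 / (t ^ 2 + s ^ 2) ≤ t := by
      rw [div_le_iff₀ hpos]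
      nlinarith [mul_nonneg ht.le (sq_nonneg s)]
    linarith
  · have hmax : ∀ m : ℝ, 0 ≤ m → s ≤ m → t ≤ m → y ≤ 2 * m := by
      intro m hm hsm htm
      by_contra! hlt
      have h1 := pow_le_pow_left₀ hs hsm 2
      have h2 := pow_le_pow_left₀ ht.le htm 3
      have h3 : (2 * m) ^ 2 ≤ y ^ 2 := pow_le_pow_left₀ (by positivity) hlt.le 2
      have h4 : (2 * m) ^ 3 ≤ y ^ 3 := pow_le_pow_left₀ (by positivity) hlt.le 3
      nlinarith [mul_le_mul_of_nonneg_right h1 hy.le, mul_le_mul_of_nonneg_right h3 hy.le,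
        pow_pos hy 3]
    rcases le_total t s with hts | hst
    · linarith [hmax s hs le_rfl hts]
    · have hqt : t / 2 ≤ t ^ 3 / (t ^ 2 + s ^ 2) := by
        rw [le_div_iff₀ hpos]
        nlinarith [mul_le_mul_of_nonneg_left (pow_le_pow_left₀ hs hst 2) ht.le]
      linarith [hmax t ht.le hst le_rfl]

/-- **Scaling of the cubic equation.** For every `x > 0` and `β ∈ ℝ`, the equation
`y³ + βy = x` has a unique positive solution, and this solution is comparable, with
absolute constants, to `√(max{0,−β}) + x/(x^{2/3} + |β|)`. -/
theorem cubic_unique_solution_scaling :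
    (∀ x β : ℝ, 0 < x → ∃! y : ℝ, 0 < y ∧ y ^ 3 + β * y = x) ∧
    ∃ c C : ℝ, 0 < c ∧ 0 < C ∧
      ∀ x β y : ℝ, 0 < x → 0 < y → y ^ 3 + β * y = x →
        c * (Real.sqrt (max 0 (-β)) + x / (x ^ ((2 : ℝ) / 3) + |β|)) ≤ y ∧
        y ≤ C * (Real.sqrt (max 0 (-β)) + x / (x ^ ((2 : ℝ) / 3) + |β|)) := by
  refine ⟨fun x β hx => existsUnique_pos_cubic_eq β hx, 1 / 2, 4, by norm_num, by norm_num, ?_⟩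
  intro x β y hx hy h
  obtain ⟨t, ht, rfl⟩ : ∃ t : ℝ, 0 < t ∧ t ^ 3 = x :=
    ⟨x ^ ((1 : ℝ) / 3), by positivity, by rw [← Real.rpow_mul_natCast hx.le]; norm_num⟩
  have hpow : (t ^ 3) ^ ((2 : ℝ) / 3) = t ^ 2 := by
    rw [← Real.rpow_natCast_mul ht.le, ← Real.rpow_natCast]
    norm_num
  rw [hpow]
  rcases le_or_gt 0 β with hβ | hβ
  · rw [abs_of_nonneg hβ, max_eq_left (neg_nonpos.mpr hβ), Real.sqrt_zero, zero_add]
    have hq : 0 ≤ t ^ 3 / (t ^ 2 + β) := by positivity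
    obtain ⟨h1, h2⟩ := cubic_root_bounds_of_nonneg ht hβ hy h
    constructor <;> linarith
  · have hs := Real.sq_sqrt (neg_nonneg.mpr hβ.le)
    obtain ⟨h1, h2⟩ := cubic_root_bounds_of_neg ht (Real.sqrt_nonneg (-β)) hy
      (by rw [hs]; linarith)
    rw [hs] at h1 h2
    rw [abs_of_neg hβ, max_eq_right (neg_nonneg.mpr hβ.le)]
    constructor <;> linarith
end

section
/- Higher order Morse lemma: Let U ⊂ ℂ be open, f : U → ℝ real analytic, and ζ₀ ∈ U with ∂_x f(ζ₀) = ∂_y f(ζ₀) = 0 and Δf(ζ₀) := (∂_x² f + ∂_y² f)(ζ₀) > 0. Then there exist an open neighbourhood V of 0 in ℂ, an open neighbourhood U₀ ⊂ U of ζ₀, a real analytic diffeomorphism Φ : V → U₀ with Φ(0) = ζ₀, a natural number K ≥ 2 and τ ∈ {−1, 0, 1} such that f(Φ(x + iy)) = f(ζ₀) + x² + τ·y^K for all x + iy ∈ V. -/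
open Complex
open Filter Topology

theorem HasFPowerSeriesOnBall.intervalIntegral_comp
    {E F : Type*} [NormedAddCommGroup E] [NormedSpace ℝ E] [NormedAddCommGroup F]
    [NormedSpace ℝ F] [CompleteSpace F] {G : E → F} {p : FormalMultilinearSeries ℝ E F}
    {r : ENNReal} (hG : HasFPowerSeriesOnBall G p 0 r) {L : ℝ → E →L[ℝ] E} (hL : Continuous L)
    (hL1 : ∀ u ∈ Set.Icc (0 : ℝ) 1, ‖L u‖ ≤ 1) :
    HasFPowerSeriesOnBall (fun z => ∫ u in (0 : ℝ)..1, G (L u z))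
      (fun n => ∫ u in (0 : ℝ)..1, (p n).compContinuousLinearMap fun _ => L u) 0 r := by
  have hcont : ∀ n, Continuous fun u => (p n).compContinuousLinearMap fun _ => L u := by
    intro n
    have h1 : Continuous fun m : (Fin n → (E →L[ℝ] E)) => (p n).compContinuousLinearMap m :=
      ((ContinuousLinearMap.apply ℝ _ (p n)).continuous.comp
        (ContinuousMultilinearMap.compContinuousLinearMapContinuousMultilinear ℝ
          (fun _ : Fin n => E) (fun _ : Fin n => E) F).cont)
    exact h1.comp (continuous_pi fun _ => hL)
  have hnorm : ∀ n, ∀ u ∈ Set.Icc (0 : ℝ) 1,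
      ‖(p n).compContinuousLinearMap fun _ => L u‖ ≤ ‖p n‖ := by
    intro n u hu
    refine (ContinuousMultilinearMap.norm_compContinuousLinearMap_le _ _).trans ?_
    refine mul_le_of_le_one_right (norm_nonneg _) ?_
    exact Finset.prod_le_one (fun _ _ => norm_nonneg _) (fun _ _ => hL1 u hu)
  have hIoc : ∀ u ∈ Set.uIoc (0 : ℝ) 1, u ∈ Set.Icc (0 : ℝ) 1 := fun u hu =>
    Set.Ioc_subset_Icc_self (by rwa [Set.uIoc_of_le zero_le_one] at hu)
  refine ⟨hG.r_le.trans (FormalMultilinearSeries.radius_le_of_le fun n => ?_), hG.r_pos, ?_⟩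
  · simpa using intervalIntegral.norm_integral_le_of_norm_le_const (a := (0 : ℝ)) (b := 1)
      fun u hu => hnorm n u (hIoc u hu)
  · intro y hy
    have hle : ∀ u ∈ Set.Icc (0 : ℝ) 1, ‖L u y‖ ≤ ‖y‖ := fun u hu => by
      simpa using (L u).le_of_opNorm_le (hL1 u hu) y
    have hmem : ∀ u ∈ Set.Icc (0 : ℝ) 1, L u y ∈ Metric.eball (0 : E) r := fun u hu => by
      rw [Metric.mem_eball, edist_zero_right] at hy ⊢
      exact (enorm_le_iff_norm_le.mpr (hle u hu)).trans_lt hy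
    have hyn : ((‖y‖₊ : NNReal) : ENNReal) < p.radius := by
      simpa [edist_zero_right, enorm_eq_nnnorm] using Metric.eball_subset_eball hG.r_le hy
    have hsum : Summable fun n => ‖p n‖ * ‖y‖ ^ n := by
      simpa only [coe_nnnorm] using p.summable_norm_mul_pow hyn
    have happ : ∀ n, (∫ u in (0 : ℝ)..1, (p n).compContinuousLinearMap fun _ => L u) (fun _ => y) =
        ∫ u in (0 : ℝ)..1, p n fun _ => L u y := fun n =>
      ((ContinuousMultilinearMap.apply ℝ (fun _ : Fin n => E) F
        fun _ => y).intervalIntegral_comp_comm ((hcont n).intervalIntegrable 0 1)).symm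
    simp only [happ, zero_add]
    refine intervalIntegral.hasSum_integral_of_dominated_convergence
      (fun n _ => ‖p n‖ * ‖y‖ ^ n) (fun n => ?_) (fun n => ?_) ?_ ?_ ?_
    · have : Continuous fun u => p n fun _ => L u y :=
        (p n).cont.comp (continuous_pi fun _ => hL.clm_apply continuous_const)
      exact this.aestronglyMeasurable
    · refine Eventually.of_forall fun u hu => ?_
      refine ((p n).le_opNorm _).trans ?_
      rw [Finset.prod_const, Finset.card_univ, Fintype.card_fin]
      gcongr
      exact hle u (hIoc u hu)
    · exact Eventually.of_forall fun _ _ => hsum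
    · exact intervalIntegrable_const
    · refine Eventually.of_forall fun u hu => ?_
      simpa using hG.hasSum (hmem u (hIoc u hu))

theorem AnalyticAt.exists_eventually_eq_add_snd_mul {F : ℝ × ℝ → ℝ} (hF : AnalyticAt ℝ F 0) :
    ∃ q : ℝ × ℝ → ℝ, AnalyticAt ℝ q 0 ∧ ∀ᶠ p in 𝓝 0, F p = F (p.1, 0) + p.2 * q p := by
  have hG : AnalyticAt ℝ (fun p => fderiv ℝ F p (0, 1)) 0 := by
    exact (ContinuousLinearMap.apply ℝ ℝ ((0, 1) : ℝ × ℝ)).analyticAt _ |>.comp hF.fderiv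
  obtain ⟨P, r, hP⟩ := hG
  let L : ℝ → ℝ × ℝ →L[ℝ] ℝ × ℝ := fun u =>
    (ContinuousLinearMap.inl ℝ ℝ ℝ).comp (ContinuousLinearMap.fst ℝ ℝ ℝ) +
      u • (ContinuousLinearMap.inr ℝ ℝ ℝ).comp (ContinuousLinearMap.snd ℝ ℝ ℝ)
  have hLapp : ∀ u p, L u p = (p.1, u * p.2) := fun u p => by simp [L]
  have hL : Continuous L := by fun_prop
  have hL1 : ∀ u ∈ Set.Icc (0 : ℝ) 1, ‖L u‖ ≤ 1 := by
    intro u hu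
    refine ContinuousLinearMap.opNorm_le_bound _ zero_le_one fun p => ?_
    rw [hLapp, one_mul, Prod.norm_def, Prod.norm_def]
    refine max_le_max le_rfl ?_
    rw [norm_mul, Real.norm_of_nonneg hu.1]
    exact mul_le_of_le_one_left (norm_nonneg _) hu.2
  refine ⟨_, (hP.intervalIntegral_comp hL hL1).analyticAt, ?_⟩
  obtain ⟨ε, hε, hball⟩ := Metric.eventually_nhds_iff_ball.mp hF.eventually_analyticAt
  filter_upwards [Metric.ball_mem_nhds (0 : ℝ × ℝ) hε] with p hp
  have hmem : ∀ u ∈ Set.Icc (0 : ℝ) 1, L u p ∈ Metric.ball (0 : ℝ × ℝ) ε := by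
    intro u hu
    rw [mem_ball_zero_iff] at hp ⊢
    exact (by simpa using (L u).le_of_opNorm_le (hL1 u hu) p : ‖L u p‖ ≤ ‖p‖).trans_lt hp
  have hderiv : ∀ u ∈ Set.uIcc (0 : ℝ) 1, HasDerivAt (fun u => F (L u p))
      (p.2 * fderiv ℝ F (L u p) (0, 1)) u := by
    intro u hu
    rw [Set.uIcc_of_le zero_le_one] at hu
    have h1 : HasDerivAt (fun u => L u p) (0, p.2) u := by
      simp only [hLapp]
      simpa using (hasDerivAt_const u p.1).prodMk ((hasDerivAt_id u).mul_const p.2)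
    have h2 := (hball _ (hmem u hu)).differentiableAt.hasFDerivAt.comp_hasDerivAt u h1
    have h3 : ((0, p.2) : ℝ × ℝ) = p.2 • (0, 1) := by simp
    rwa [h3, map_smul, smul_eq_mul] at h2
  have hcont : ContinuousOn (fun u => p.2 * fderiv ℝ F (L u p) (0, 1)) (Set.uIcc 0 1) := by
    rw [Set.uIcc_of_le zero_le_one]
    intro u hu
    have h1 : ContinuousAt (fderiv ℝ F) (L u p) := (hball _ (hmem u hu)).fderiv.continuousAt
    have h2 : ContinuousAt (fun u => L u p) u := by fun_prop
    have h3 : ContinuousAt (fun u => fderiv ℝ F (L u p)) u := ContinuousAt.comp h1 h2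
    exact (by fun_prop : ContinuousAt (fun u => p.2 * fderiv ℝ F (L u p) (0, 1)) u)
      |>.continuousWithinAt
  have := intervalIntegral.integral_eq_sub_of_hasDerivAt hderiv hcont.intervalIntegrable
  rw [intervalIntegral.integral_const_mul] at this
  rw [this]
  simp [hLapp]

theorem AnalyticAt.exists_eventually_eq_add_snd_sq_mul {h : ℝ × ℝ → ℝ} (hh : AnalyticAt ℝ h 0)
    (h0 : ∀ᶠ t : ℝ in 𝓝 0, fderiv ℝ h (t, 0) (0, 1) = 0) :
    ∃ q : ℝ × ℝ → ℝ, AnalyticAt ℝ q 0 ∧ (∀ᶠ p in 𝓝 0, h p = h (p.1, 0) + p.2 ^ 2 * q p) ∧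
      fderiv ℝ (fun p => fderiv ℝ h p (0, 1)) 0 (0, 1) = 2 * q 0 := by
  have hline : Tendsto (fun t : ℝ => ((t, 0) : ℝ × ℝ)) (𝓝 0) (𝓝 0) :=
    (by fun_prop : Continuous fun t : ℝ => ((t, 0) : ℝ × ℝ)).tendsto' 0 0 rfl
  have hfst : Tendsto (fun p : ℝ × ℝ => p.1) (𝓝 0) (𝓝 0) := continuous_fst.tendsto' 0 0 rfl
  have hpt : Tendsto (fun p : ℝ × ℝ => ((p.1, 0) : ℝ × ℝ)) (𝓝 0) (𝓝 0) := hline.comp hfst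
  -- the transversal derivative of `h (p.1, 0) + w p`
  have hpartial : ∀ {w : ℝ × ℝ → ℝ}, AnalyticAt ℝ w 0 → (∀ᶠ p in 𝓝 0, h p = h (p.1, 0) + w p) →
      ∀ᶠ p in 𝓝 0, fderiv ℝ h p (0, 1) = fderiv ℝ w p (0, 1) := by
    intro w hw hE
    filter_upwards [hE.eventually_nhds, hw.eventually_analyticAt,
      hpt.eventually hh.eventually_analyticAt] with p hp hwp hhp
    have h1 : HasFDerivAt (fun p : ℝ × ℝ => ((p.1, 0) : ℝ × ℝ))
        ((ContinuousLinearMap.fst ℝ ℝ ℝ).prod 0) p :=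
      hasFDerivAt_fst.prodMk (hasFDerivAt_const _ _)
    have h2 := (HasFDerivAt.comp p hhp.differentiableAt.hasFDerivAt h1).add
      hwp.differentiableAt.hasFDerivAt
    rw [(h2.congr_of_eventuallyEq hp).fderiv]
    simp [← Prod.zero_eq_mk]
  obtain ⟨q₁, hq₁, hE₁⟩ := hh.exists_eventually_eq_add_snd_mul
  obtain ⟨q, hq, hE⟩ := hq₁.exists_eventually_eq_add_snd_mul
  have hq₁0 : ∀ᶠ t : ℝ in 𝓝 0, q₁ (t, 0) = 0 := by
    have hw : AnalyticAt ℝ (fun p : ℝ × ℝ => p.2 * q₁ p) 0 := analyticAt_snd.mul hq₁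
    filter_upwards [h0, hline.eventually (hpartial hw hE₁),
      hline.eventually hq₁.eventually_analyticAt] with t ht hp hqa
    rw [ht, ((hasFDerivAt_snd (p := ((t, 0) : ℝ × ℝ))).fun_mul
      hqa.differentiableAt.hasFDerivAt).fderiv] at hp
    simpa using hp.symm
  have hE₂ : ∀ᶠ p in 𝓝 0, h p = h (p.1, 0) + p.2 ^ 2 * q p := by
    filter_upwards [hE₁, hE, hfst.eventually hq₁0] with p h1 h2 h3
    rw [h1, h2, h3]
    ring
  refine ⟨q, hq, hE₂, ?_⟩
  have hw : AnalyticAt ℝ (fun p : ℝ × ℝ => p.2 ^ 2 * q p) 0 := (analyticAt_snd.pow 2).mul hq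
  have hD : (fun p => fderiv ℝ h p (0, 1)) =ᶠ[𝓝 0]
      fun p => p.2 * (2 * q p + p.2 * fderiv ℝ q p (0, 1)) := by
    filter_upwards [hpartial hw hE₂, hq.eventually_analyticAt] with p hp hqa
    rw [hp, (((hasFDerivAt_snd (p := p)).pow 2).fun_mul hqa.differentiableAt.hasFDerivAt).fderiv]
    simp
    ring
  have hr : AnalyticAt ℝ (fun p => 2 * q p + p.2 * fderiv ℝ q p (0, 1)) 0 := by
    exact (analyticAt_const.mul hq).add (analyticAt_snd.mul
      ((ContinuousLinearMap.apply ℝ ℝ ((0, 1) : ℝ × ℝ)).analyticAt _ |>.comp hq.fderiv))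
  rw [hD.fderiv_eq, ((hasFDerivAt_snd (p := (0 : ℝ × ℝ))).fun_mul
    hr.differentiableAt.hasFDerivAt).fderiv]
  simp

theorem AnalyticAt.exists_eventually_eq_add_mul_pow {c : ℝ → ℝ} (hc : AnalyticAt ℝ c 0)
    (hc' : deriv c 0 = 0) :
    ∃ (ρ : ℝ → ℝ) (K : ℕ) (τ : ℝ), AnalyticAt ℝ ρ 0 ∧ ρ 0 ≠ 0 ∧ 2 ≤ K ∧
      (τ = -1 ∨ τ = 0 ∨ τ = 1) ∧ ∀ᶠ t in 𝓝 0, c t = c 0 + τ * (t * ρ t) ^ K := by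
  have hd : AnalyticAt ℝ (fun t => c t - c 0) 0 := by fun_prop
  by_cases hz : ∀ᶠ t in 𝓝 0, c t - c 0 = 0
  · refine ⟨fun _ => 1, 2, 0, analyticAt_const, one_ne_zero, le_rfl, by simp, ?_⟩
    filter_upwards [hz] with t ht
    linarith
  obtain ⟨K, r, hr, hr0, hE⟩ := hd.exists_eventuallyEq_pow_smul_nonzero_iff.mpr hz
  simp only [sub_zero, smul_eq_mul] at hE
  have hK : 2 ≤ K := by
    by_contra! hlt
    interval_cases K
    · exact hr0 (by simpa using hE.self_of_nhds.symm)
    · have h1 : HasDerivAt (fun t => t ^ 1 * r t) (r 0) 0 := by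
        simpa using (hasDerivAt_pow 1 (0 : ℝ)).fun_mul hr.differentiableAt.hasDerivAt
      have h2 := (h1.congr_of_eventuallyEq hE).deriv
      rw [deriv_sub_const, hc'] at h2
      exact hr0 h2.symm
  obtain ⟨τ, hτ, hτr⟩ : ∃ τ : ℝ, (τ = -1 ∨ τ = 1) ∧ 0 < τ * r 0 := by
    rcases lt_or_gt_of_ne hr0 with h | h
    · exact ⟨-1, by simp, by linarith⟩
    · exact ⟨1, by simp, by linarith⟩
  have hτ2 : τ * τ = 1 := by rcases hτ with rfl | rfl <;> norm_num
  have hpos : ∀ᶠ t in 𝓝 0, 0 < τ * r t :=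
    (continuousAt_const.mul hr.continuousAt).eventually_const_lt hτr
  refine ⟨fun t => Real.exp (Real.log (τ * r t) / K), K, τ, ?_, (Real.exp_pos _).ne', hK,
    by tauto, ?_⟩
  · have := (analyticAt_const (v := τ)).mul hr |>.log hτr
    have hKinv : AnalyticAt ℝ (fun t => Real.log (τ * r t) * (K : ℝ)⁻¹) 0 :=
      this.mul analyticAt_const
    simpa only [div_eq_mul_inv, Function.comp_def] using hKinv.rexp
  · filter_upwards [hE, hpos] with t ht hp
    have hK0 : (K : ℝ) ≠ 0 := by positivity
    rw [mul_pow, ← Real.exp_nat_mul, mul_div_cancel₀ _ hK0, Real.exp_log hp]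
    linear_combination ht - t ^ K * r t * hτ2

open scoped ContDiff in
theorem AnalyticAt.exists_critical_graph {g : ℝ × ℝ → ℝ} (hg : AnalyticAt ℝ g 0)
    (h1 : fderiv ℝ g 0 = 0)
    (h2 : fderiv ℝ (fun p => fderiv ℝ g p (0, 1)) 0 (0, 1) ≠ 0) :
    ∃ σ : ℝ → ℝ, AnalyticAt ℝ σ 0 ∧ σ 0 = 0 ∧
      ∀ᶠ t : ℝ in 𝓝 0, fderiv ℝ g (t, σ t) (0, 1) = 0 := by
  have hG : AnalyticAt ℝ (fun p => fderiv ℝ g p (0, 1)) 0 :=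
    (ContinuousLinearMap.apply ℝ ℝ ((0, 1) : ℝ × ℝ)).analyticAt _ |>.comp hg.fderiv
  have cdf : ContDiffAt ℝ ω (fun p => fderiv ℝ g p (0, 1)) 0 := hG.contDiffAt
  have hinv : (fderiv ℝ (fun p => fderiv ℝ g p (0, 1)) 0 ∘L .inr ℝ ℝ ℝ).IsInvertible := by
    refine ⟨ContinuousLinearEquiv.unitsEquivAut ℝ (Units.mk0 _ h2), ?_⟩
    ext
    simp
  have hω : (ω : WithTop ℕ∞) ≠ 0 := by simp
  refine ⟨cdf.implicitFunction hω hinv, (cdf.contDiffAt_implicitFunction hω hinv).analyticAt,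
    cdf.implicitFunction_apply_self hω hinv, ?_⟩
  filter_upwards [cdf.eventually_apply_implicitFunction hω hinv] with t ht
  rw [ht, h1]
  rfl

theorem AnalyticAt.exists_normal_form_of_critical {g : ℝ × ℝ → ℝ} (hg : AnalyticAt ℝ g 0)
    (h1 : fderiv ℝ g 0 = 0)
    (h2 : 0 < fderiv ℝ (fun p => fderiv ℝ g p (0, 1)) 0 (0, 1)) :
    ∃ (ψ : ℝ × ℝ → ℝ × ℝ) (K : ℕ) (τ : ℝ), AnalyticAt ℝ ψ 0 ∧ ψ 0 = 0 ∧
      Function.Injective (fderiv ℝ ψ 0) ∧ 2 ≤ K ∧ (τ = -1 ∨ τ = 0 ∨ τ = 1) ∧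
      ∀ᶠ p in 𝓝 0, g p = g 0 + (ψ p).2 ^ 2 + τ * (ψ p).1 ^ K := by
  obtain ⟨σ, hσ, hσ0, hσc⟩ := hg.exists_critical_graph h1 h2.ne'
  have hG : AnalyticAt ℝ (fun p => fderiv ℝ g p (0, 1)) 0 :=
    (ContinuousLinearMap.apply ℝ ℝ ((0, 1) : ℝ × ℝ)).analyticAt _ |>.comp hg.fderiv
  have hfst0 : AnalyticAt ℝ (fun p : ℝ × ℝ => σ p.1) 0 :=
    AnalyticAt.fun_comp (f := Prod.fst) (g := σ) (x := (0 : ℝ × ℝ)) hσ analyticAt_fst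
  -- the shear moving the critical graph to the first axis, and its inverse
  let θ : ℝ × ℝ → ℝ × ℝ := fun p => (p.1, p.2 + σ p.1)
  let η : ℝ × ℝ → ℝ × ℝ := fun p => (p.1, p.2 - σ p.1)
  have hθη : ∀ p, θ (η p) = p := fun p => by simp [θ, η]
  have hθ : AnalyticAt ℝ θ 0 := analyticAt_fst.prod (analyticAt_snd.add hfst0)
  have hη : AnalyticAt ℝ η 0 := analyticAt_fst.prod (analyticAt_snd.sub hfst0)
  have hθ0 : θ 0 = 0 := by simp [θ, hσ0]
  have hη0 : η 0 = 0 := by simp [η, hσ0]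
  have hηt : Tendsto η (𝓝 0) (𝓝 0) := by simpa [hη0] using hη.continuousAt.tendsto
  have hθt : Tendsto θ (𝓝 0) (𝓝 0) := by simpa [hθ0] using hθ.continuousAt.tendsto
  have hθd : ∀ p : ℝ × ℝ, AnalyticAt ℝ σ p.1 → ∃ θ' : ℝ × ℝ →L[ℝ] ℝ × ℝ,
      HasFDerivAt θ θ' p ∧ θ' (0, 1) = (0, 1) := by
    intro p hp
    refine ⟨_, hasFDerivAt_fst.prodMk (hasFDerivAt_snd.add
      (hp.differentiableAt.hasFDerivAt.comp p hasFDerivAt_fst)), ?_⟩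
    simp
  have hh : AnalyticAt ℝ (fun p => g (θ p)) 0 :=
    AnalyticAt.fun_comp (by rwa [hθ0]) hθ
  have hhd : (fun p => fderiv ℝ (fun p => g (θ p)) p (0, 1)) =ᶠ[𝓝 0]
      fun p => fderiv ℝ g (θ p) (0, 1) := by
    filter_upwards [hθt.eventually hg.eventually_analyticAt,
      (continuous_fst.tendsto' (0 : ℝ × ℝ) 0 rfl).eventually hσ.eventually_analyticAt]
      with p hgp hσp
    obtain ⟨θ', hd, he⟩ := hθd p hσp
    have hcomp : HasFDerivAt (fun p => g (θ p)) _ p := hgp.differentiableAt.hasFDerivAt.comp p hd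
    rw [hcomp.fderiv]
    simp [he]
  obtain ⟨q, hq, hE, hq2⟩ := hh.exists_eventually_eq_add_snd_sq_mul (by
    have hline : Tendsto (fun t : ℝ => ((t, 0) : ℝ × ℝ)) (𝓝 0) (𝓝 0) :=
      (by fun_prop : Continuous fun t : ℝ => ((t, 0) : ℝ × ℝ)).tendsto' 0 0 rfl
    filter_upwards [hline.eventually hhd, hσc] with t ht hc
    rw [ht]
    simpa [θ] using hc)
  have hq0 : 0 < q 0 := by
    obtain ⟨θ', hd, he⟩ := hθd 0 hσ
    have hG' := hG.differentiableAt.hasFDerivAt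
    rw [← hθ0] at hG'
    have hcomp : HasFDerivAt (fun p => fderiv ℝ g (θ p) (0, 1)) _ 0 := hG'.comp 0 hd
    rw [hhd.fderiv_eq, hcomp.fderiv, ContinuousLinearMap.comp_apply, he, hθ0] at hq2
    linarith
  have hγ : AnalyticAt ℝ (fun t => ((t, σ t) : ℝ × ℝ)) 0 := analyticAt_id.prod hσ
  have hγ0 : ((0, σ 0) : ℝ × ℝ) = 0 := by simp [hσ0]
  have hgγ : AnalyticAt ℝ g (0, σ 0) := by rwa [hγ0]
  have hc : AnalyticAt ℝ (fun t => g (t, σ t)) 0 := AnalyticAt.fun_comp hgγ hγ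
  have hc' : deriv (fun t => g (t, σ t)) 0 = 0 := by
    have hgd := hgγ.differentiableAt.hasFDerivAt
    rw [hγ0, h1, ← hγ0] at hgd
    exact (hgd.comp_hasDerivAt (0 : ℝ) hγ.differentiableAt.hasDerivAt).deriv
  obtain ⟨ρ, K, τ, hρ, hρ0, hK, hτ, hcE⟩ := hc.exists_eventually_eq_add_mul_pow hc'
  rw [hγ0] at hcE
  have hqη : AnalyticAt ℝ (fun p => q (η p)) 0 := AnalyticAt.fun_comp (by rwa [hη0]) hη
  have hroot : AnalyticAt ℝ (fun p => Real.exp (Real.log (q (η p)) * 2⁻¹)) 0 := by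
    have hqη0 : 0 < q (η 0) := by rwa [hη0]
    have hlog := (analyticAt_log hqη0).fun_comp (f := fun p => q (η p)) hqη
    have hmul : AnalyticAt ℝ (fun p => Real.log (q (η p)) * 2⁻¹) 0 := hlog.mul analyticAt_const
    simpa only [Function.comp_def] using hmul.rexp
  have hρfst : AnalyticAt ℝ (fun p : ℝ × ℝ => ρ p.1) 0 :=
    AnalyticAt.fun_comp (f := Prod.fst) (g := ρ) (x := (0 : ℝ × ℝ)) hρ analyticAt_fst
  refine ⟨fun p => (p.1 * ρ p.1, (p.2 - σ p.1) * Real.exp (Real.log (q (η p)) * 2⁻¹)), K, τ,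
    (analyticAt_fst.mul hρfst).prod ((analyticAt_snd.sub hfst0).mul hroot), by simp [hσ0], ?_,
    hK, hτ, ?_⟩
  · have hd := ((hasFDerivAt_fst (𝕜 := ℝ) (p := (0 : ℝ × ℝ))).fun_mul
      hρfst.differentiableAt.hasFDerivAt).prodMk
      (((hasFDerivAt_snd (𝕜 := ℝ) (p := (0 : ℝ × ℝ))).fun_sub
        (HasFDerivAt.comp (g := σ) (0 : ℝ × ℝ) hσ.differentiableAt.hasFDerivAt
          hasFDerivAt_fst)).fun_mul hroot.differentiableAt.hasFDerivAt)
    erw [hd.fderiv]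
    rw [injective_iff_map_eq_zero]
    rintro ⟨a, b⟩ hab
    simp [hσ0, hρ0, Real.exp_ne_zero] at hab
    obtain ⟨rfl, hb⟩ := hab
    simpa using hb
  · filter_upwards [hηt.eventually hE, hηt.eventually (hq.continuousAt.eventually_const_lt hq0),
      (continuous_fst.tendsto' (0 : ℝ × ℝ) 0 rfl).eventually hcE] with p hp hqp hcp
    rw [hθη] at hp
    have hexp : Real.exp (Real.log (q (η p)) * 2⁻¹) ^ 2 = q (η p) := by
      rw [← Real.exp_nat_mul]
      convert Real.exp_log hqp using 2
      push_cast
      ring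
    have hax : θ ((η p).1, 0) = (p.1, σ p.1) := by simp [θ, η]
    rw [hp, hax, hcp, mul_pow (p.2 - σ p.1), hexp]
    ring

theorem AnalyticAt.exists_bijOn_of_injective_fderiv {E : Type*} [NormedAddCommGroup E]
    [NormedSpace ℝ E] [FiniteDimensional ℝ E] {Ψ : E → E} {a : E} (hΨ : AnalyticAt ℝ Ψ a)
    (hinj : Function.Injective (fderiv ℝ Ψ a)) {N : Set E} (hN : N ∈ 𝓝 a) :
    ∃ (V U₀ : Set E) (Φ : E → E), IsOpen V ∧ Ψ a ∈ V ∧ IsOpen U₀ ∧ U₀ ⊆ N ∧ a ∈ U₀ ∧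
      Φ (Ψ a) = a ∧ Set.BijOn Φ V U₀ ∧ (∀ z ∈ V, AnalyticAt ℝ Φ z) ∧ Set.InvOn Ψ Φ V U₀ ∧
      ∀ w ∈ U₀, AnalyticAt ℝ Ψ w := by
  have := FiniteDimensional.complete ℝ E
  let i : E ≃L[ℝ] E :=
    (LinearEquiv.ofInjectiveEndo (fderiv ℝ Ψ a : E →ₗ[ℝ] E) hinj).toContinuousLinearEquiv
  have hi : fderiv ℝ Ψ a = i := by
    ext v
    rfl
  have hstrict : HasStrictFDerivAt Ψ (i : E →L[ℝ] E) a := hi ▸ hΨ.hasStrictFDerivAt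
  let R := hstrict.toOpenPartialHomeomorph Ψ
  have hR : (R : E → E) = Ψ := hstrict.toOpenPartialHomeomorph_coe
  have ha : a ∈ R.source := hstrict.mem_toOpenPartialHomeomorph_source
  have hsymm : AnalyticAt ℝ R.symm (Ψ a) := by
    have := R.analyticAt_symm' (i := i) ha (hR ▸ hΨ) (hR ▸ hi)
    rwa [hR] at this
  obtain ⟨O, hO, hOopen, haO⟩ := eventually_nhds_iff.mp
    (Filter.inter_mem hN (hΨ.eventually_analyticAt.and
      (hΨ.continuousAt.eventually hsymm.eventually_analyticAt)))
  let S := R.restrOpen O hOopen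
  have hS : (S : E → E) = Ψ := hR
  have haS : a ∈ S.source := ⟨ha, haO⟩
  have hSO : S.source ⊆ O := fun _ h => h.2
  refine ⟨S.target, S.source, S.symm, S.open_target, ?_, S.open_source,
    fun w hw => (hO w (hSO hw)).1, haS, ?_, S.symm.bijOn, ?_, ?_, fun w hw => (hO w (hSO hw)).2.1⟩
  · rw [← hS]; exact S.map_source haS
  · rw [← hS]; exact S.left_inv haS
  · intro z hz
    have := (hO _ (hSO (S.map_target hz))).2.2
    rw [← hS, S.right_inv hz] at this
    exact this
  · rw [← hS]; exact ⟨fun z hz => S.right_inv hz, fun w hw => S.left_inv hw⟩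

theorem exists_normal_form_of_linear_coordinates {U : Set ℂ} (hU : IsOpen U) {f : ℂ → ℝ} {ζ₀ : ℂ}
    (hf : AnalyticAt ℝ f ζ₀) (hζ₀ : ζ₀ ∈ U) (hf' : fderiv ℝ f ζ₀ = 0) (L : (ℝ × ℝ) ≃L[ℝ] ℂ)
    (hL : 0 < fderiv ℝ (fun z => fderiv ℝ f z (L (0, 1))) ζ₀ (L (0, 1))) :
    ∃ (V U₀ : Set ℂ) (Φ Ψ : ℂ → ℂ) (K : ℕ) (τ : ℝ),
      IsOpen V ∧ (0 : ℂ) ∈ V ∧ IsOpen U₀ ∧ U₀ ⊆ U ∧ ζ₀ ∈ U₀ ∧ Φ 0 = ζ₀ ∧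
      Set.BijOn Φ V U₀ ∧ (∀ z ∈ V, AnalyticAt ℝ Φ z) ∧
      Set.InvOn Ψ Φ V U₀ ∧ (∀ w ∈ U₀, AnalyticAt ℝ Ψ w) ∧
      2 ≤ K ∧ (τ = -1 ∨ τ = 0 ∨ τ = 1) ∧
      ∀ z ∈ V, f (Φ z) = f ζ₀ + z.re ^ 2 + τ * z.im ^ K := by
  let A : ℝ × ℝ → ℂ := fun p => ζ₀ + L p
  have hA0 : A 0 = ζ₀ := by simp [A]
  have hA : AnalyticAt ℝ A 0 := analyticAt_const.add (L.toContinuousLinearMap.analyticAt 0)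
  have hAt : Tendsto A (𝓝 0) (𝓝 ζ₀) := by simpa [hA0] using hA.continuousAt.tendsto
  have hAd : ∀ p, HasFDerivAt A (L : ℝ × ℝ →L[ℝ] ℂ) p := fun p =>
    L.toContinuousLinearMap.hasFDerivAt.const_add ζ₀
  have hg : AnalyticAt ℝ (fun p => f (A p)) 0 := AnalyticAt.fun_comp (by rwa [hA0]) hA
  have hfd : ∀ {v : ℂ → ℝ} {p : ℝ × ℝ}, AnalyticAt ℝ v (A p) → ∀ w,
      fderiv ℝ (fun p => v (A p)) p w = fderiv ℝ v (A p) (L w) := by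
    intro v p hv w
    have hcomp : HasFDerivAt (fun p => v (A p)) _ p :=
      hv.differentiableAt.hasFDerivAt.comp p (hAd p)
    rw [hcomp.fderiv]
    rfl
  have h1 : fderiv ℝ (fun p => f (A p)) 0 = 0 := by
    refine ContinuousLinearMap.ext fun w => ?_
    rw [hfd (by rwa [hA0]), hA0, hf']
    rfl
  have h2 : 0 < fderiv ℝ (fun p => fderiv ℝ (fun p => f (A p)) p (0, 1)) 0 (0, 1) := by
    have hE : (fun p => fderiv ℝ (fun p => f (A p)) p (0, 1)) =ᶠ[𝓝 0]
        fun p => fderiv ℝ f (A p) (L (0, 1)) := by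
      filter_upwards [hAt.eventually hf.eventually_analyticAt] with p hp
      exact hfd hp _
    have hGa : AnalyticAt ℝ (fun z => fderiv ℝ f z (L (0, 1))) (A 0) := by
      rw [hA0]
      exact (ContinuousLinearMap.apply ℝ ℝ (L (0, 1))).analyticAt _ |>.comp hf.fderiv
    rw [hE.fderiv_eq, hfd hGa, hA0]
    exact hL
  obtain ⟨ψ, K, τ, hψ, hψ0, hinj, hK, hτ, hE⟩ := hg.exists_normal_form_of_critical h1 h2
  let M : (ℝ × ℝ) ≃L[ℝ] ℂ :=
    (ContinuousLinearEquiv.prodComm ℝ ℝ ℝ).trans equivRealProdCLM.symm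
  have hMre : ∀ p, (M p).re = p.2 := fun p => by simp [M]
  have hMim : ∀ p, (M p).im = p.1 := fun p => by simp [M]
  let B : ℂ → ℝ × ℝ := fun z => L.symm (z - ζ₀)
  have hB0 : B ζ₀ = 0 := by simp [B]
  have hAB : ∀ z, A (B z) = z := fun z => by simp [A, B]
  have hBd : HasFDerivAt B (L.symm : ℂ →L[ℝ] ℝ × ℝ) ζ₀ :=
    L.symm.toContinuousLinearMap.hasFDerivAt.comp ζ₀ ((hasFDerivAt_id ζ₀).sub_const ζ₀)
  have hB : AnalyticAt ℝ B ζ₀ :=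
    AnalyticAt.fun_comp (L.symm.toContinuousLinearMap.analyticAt _)
      (analyticAt_id.sub analyticAt_const)
  have hψB : AnalyticAt ℝ ψ (B ζ₀) := by rwa [hB0]
  have hΨ : AnalyticAt ℝ (fun z => M (ψ (B z))) ζ₀ :=
    AnalyticAt.fun_comp (M.toContinuousLinearMap.analyticAt _) (AnalyticAt.fun_comp hψB hB)
  have hΨd : HasFDerivAt (fun z => M (ψ (B z))) _ ζ₀ :=
    M.toContinuousLinearMap.hasFDerivAt.comp ζ₀ (hψB.differentiableAt.hasFDerivAt.comp ζ₀ hBd)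
  have hΨinj : Function.Injective (fderiv ℝ (fun z => M (ψ (B z))) ζ₀) := by
    rw [hΨd.fderiv, hB0]
    exact M.injective.comp (hinj.comp L.symm.injective)
  have hBt : Tendsto B (𝓝 ζ₀) (𝓝 0) := by simpa [hB0] using hB.continuousAt.tendsto
  obtain ⟨V, U₀, Φ, hV, h0V, hU₀, hsub, hζU, hΦ0, hbij, hΦ, hinv, hΨa⟩ :=
    hΨ.exists_bijOn_of_injective_fderiv hΨinj (inter_mem (hU.mem_nhds hζ₀) (hBt.eventually hE))
  have hΨ0 : M (ψ (B ζ₀)) = 0 := by rw [hB0, hψ0, map_zero]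
  rw [hΨ0] at h0V hΦ0
  refine ⟨V, U₀, Φ, _, K, τ, hV, h0V, hU₀, hsub.trans Set.inter_subset_left, hζU, hΦ0, hbij, hΦ,
    hinv, hΨa, hK, hτ, fun z hz => ?_⟩
  have hval : f (A (B (Φ z))) = _ := (hsub (hbij.mapsTo hz)).2
  have hz' : M (ψ (B (Φ z))) = z := hinv.1 hz
  rwa [hAB, hA0, ← hMre, ← hMim, hz'] at hval

/-- **Higher order Morse lemma.** If `f` is real analytic on an open set `U ⊂ ℂ` with a
critical point `ζ₀ ∈ U` at which the Laplacian is strictly positive, then in suitable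
real analytic coordinates `f` takes the normal form `f(ζ₀) + x² + τ·y^K` with `K ≥ 2`
and `τ ∈ {−1, 0, 1}`. -/
theorem higher_order_morse_lemma (U : Set ℂ) (hU : IsOpen U) (f : ℂ → ℝ)
    (hf : ∀ z ∈ U, AnalyticAt ℝ f z) (ζ₀ : ℂ) (hζ₀ : ζ₀ ∈ U)
    (hfx : fderiv ℝ f ζ₀ 1 = 0) (hfy : fderiv ℝ f ζ₀ Complex.I = 0)
    (hΔ : 0 < fderiv ℝ (fun z => fderiv ℝ f z 1) ζ₀ 1
        + fderiv ℝ (fun z => fderiv ℝ f z Complex.I) ζ₀ Complex.I) :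
    ∃ (V U₀ : Set ℂ) (Φ Ψ : ℂ → ℂ) (K : ℕ) (τ : ℝ),
      IsOpen V ∧ (0 : ℂ) ∈ V ∧ IsOpen U₀ ∧ U₀ ⊆ U ∧ ζ₀ ∈ U₀ ∧ Φ 0 = ζ₀ ∧
      Set.BijOn Φ V U₀ ∧ (∀ z ∈ V, AnalyticAt ℝ Φ z) ∧
      Set.InvOn Ψ Φ V U₀ ∧ (∀ w ∈ U₀, AnalyticAt ℝ Ψ w) ∧
      2 ≤ K ∧ (τ = -1 ∨ τ = 0 ∨ τ = 1) ∧
      ∀ z ∈ V, f (Φ z) = f ζ₀ + z.re ^ 2 + τ * z.im ^ K := by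
  have hf' : fderiv ℝ f ζ₀ = 0 := by
    ext w
    have hw : w = w.re • (1 : ℂ) + w.im • I := by simp [re_add_im]
    rw [hw, map_add, map_smul, map_smul, hfx, hfy]
    simp
  have h1 : equivRealProdCLM.symm (1, 0) = 1 := by apply Complex.ext <;> simp
  have hI : equivRealProdCLM.symm (0, 1) = I := by apply Complex.ext <;> simp
  rcases lt_or_ge 0 (fderiv ℝ (fun z => fderiv ℝ f z 1) ζ₀ 1) with hx | hx
  · exact exists_normal_form_of_linear_coordinates hU (hf ζ₀ hζ₀) hζ₀ hf'
      ((ContinuousLinearEquiv.prodComm ℝ ℝ ℝ).trans equivRealProdCLM.symm) (by simpa [h1] using hx)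
  · have hy : 0 < fderiv ℝ (fun z => fderiv ℝ f z I) ζ₀ I := by linarith
    exact exists_normal_form_of_linear_coordinates hU (hf ζ₀ hζ₀) hζ₀ hf' equivRealProdCLM.symm
      (by simpa [hI] using hy)
end

section
/- Higher order Morse lemma with symmetry: Let U ⊂ ℂ be open with 0 ∈ U and f : U → ℝ real analytic with ∂_x f(0) = ∂_y f(0) = 0, Δf(0) := (∂_x² f + ∂_y² f)(0) > 0, and ∂_x² f(0) > 0. Assume f(ζ) = f(−conj(ζ)) for all ζ ∈ U with −conj(ζ) ∈ U. Then there exist an open neighbourhood V of 0 in ℂ, an open neighbourhood U₀ ⊂ U of 0, and a real analytic diffeomorphism Φ : V → U₀ with Φ(0) = 0 whose (real) derivative at 0, as a linear map ℝ² → ℝ², is represented by a diagonal matrix with strictly positive diagonal entries, such that: if there exists l ≥ 1 with ∂_y^l f(0) ≠ 0 and K denotes the smallest such l (necessarily K ≥ 2), then f(Φ(x + iy)) = f(0) + x² + sign(∂_y^K f(0))·y^K for all x + iy ∈ V; and if ∂_y^l f(0) = 0 for all l ≥ 1, then f(Φ(x + iy)) = f(0) + x² for all x + iy ∈ V. -/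
open Complex

section
variable {𝕜 E F : Type*} [NontriviallyNormedField 𝕜] [NormedAddCommGroup E] [NormedSpace 𝕜 E]
  [NormedAddCommGroup F] [NormedSpace 𝕜 F]

namespace ContinuousMultilinearMap

/-- The `k`-th term of the telescoping expansion of `p (a, …, a) - p (b, …, b)`, as a multilinear
map in the pair `(a, b)` with values in linear maps in `a - b`. -/
noncomputable def dividedDifferenceTerm {n : ℕ} (p : E [×(n + 1)]→L[𝕜] F) (k : Fin (n + 1)) :
    (E × E) [×n]→L[𝕜] (E →L[𝕜] F) :=
  (p.curryMid k).flipMultilinear.compContinuousLinearMap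
    fun i => if k.succAbove i < k then ContinuousLinearMap.snd 𝕜 E E
      else ContinuousLinearMap.fst 𝕜 E E

theorem norm_dividedDifferenceTerm_le {n : ℕ} (p : E [×(n + 1)]→L[𝕜] F) (k : Fin (n + 1)) :
    ‖p.dividedDifferenceTerm k‖ ≤ ‖p‖ := by
  refine (norm_compContinuousLinearMap_le _ _).trans ?_
  refine (mul_le_mul ?_ ?_ (Finset.prod_nonneg fun _ _ => norm_nonneg _) (norm_nonneg p)).trans_eq
    (mul_one _)
  · refine ContinuousMultilinearMap.opNorm_le_bound (norm_nonneg _) fun m => ?_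
    refine ContinuousLinearMap.opNorm_le_bound _ (by positivity) fun x => ?_
    have := norm_map_insertNth_le p (i := k) x m
    simp only [ContinuousLinearMap.flipMultilinear_apply_apply, curryMid_apply]
    linarith
  · refine Finset.prod_le_one (fun _ _ => norm_nonneg _) fun i _ => ?_
    split_ifs
    · exact ContinuousLinearMap.norm_snd_le 𝕜 E E
    · exact ContinuousLinearMap.norm_fst_le 𝕜 E E

theorem dividedDifferenceTerm_apply_sub {n : ℕ} (p : E [×(n + 1)]→L[𝕜] F) (k : Fin (n + 1))
    (a b : E) :
    p.dividedDifferenceTerm k (fun _ => (a, b)) (a - b) =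
      p (fun i => if (i : ℕ) < k then b else a) - p (fun i => if (i : ℕ) < k + 1 then b else a) := by
  have key (x : E) : k.insertNth x (fun i => if k.succAbove i < k then b else a) =
      Function.update (fun i : Fin (n + 1) => if (i : ℕ) < k then b else a) k x := by
    ext i
    refine Fin.succAboveCases k ?_ (fun j => ?_) i
    · simp
    · simp only [Fin.insertNth_apply_succAbove, ne_eq, Fin.succAbove_ne, not_false_eq_true,
        Function.update_of_ne, Fin.lt_def]
  have h : p.dividedDifferenceTerm k (fun _ => (a, b)) (a - b) =
      p (k.insertNth (a - b) (fun i => if k.succAbove i < k then b else a)) := by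
    simp only [dividedDifferenceTerm, compContinuousLinearMap_apply,
      ContinuousLinearMap.flipMultilinear_apply_apply, curryMid_apply]
    congr 2
    ext i
    split_ifs <;> rfl
  rw [h, key, p.map_update_sub]
  congr 2 <;> ext i <;> rcases eq_or_ne i k with rfl | hi
  · simp
  · simp [hi]
  · simp
  · have : (i : ℕ) < k ↔ (i : ℕ) < k + 1 := by
      have := Fin.val_ne_of_ne hi
      omega
    rw [Function.update_of_ne hi]
    exact if_congr this rfl rfl

theorem sum_dividedDifferenceTerm_apply_sub {n : ℕ} (p : E [×(n + 1)]→L[𝕜] F) (a b : E) :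
    (∑ k, p.dividedDifferenceTerm k) (fun _ => (a, b)) (a - b) =
      p (fun _ => a) - p (fun _ => b) := by
  rw [sum_apply, _root_.sum_apply]
  simp only [dividedDifferenceTerm_apply_sub]
  rw [Fin.sum_univ_eq_sum_range (fun k => p (fun i => if (i : ℕ) < k then b else a) -
      p (fun i => if (i : ℕ) < k + 1 then b else a)), Finset.sum_range_sub']
  simp only [not_lt_zero, if_false, Fin.is_lt, if_true]

end ContinuousMultilinearMap

open Topology Filter ContinuousMultilinearMap in
/-- Hadamard lemma: increments of an analytic function are given by an analytic family of
linear maps applied to the increment of the variable. -/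
theorem AnalyticAt.exists_dividedDifference [CompleteSpace F] {f : E → F} {x : E}
    (hf : AnalyticAt 𝕜 f x) :
    ∃ D : E × E → E →L[𝕜] F, AnalyticAt 𝕜 D (x, x) ∧
      ∀ᶠ w in 𝓝 (x, x), f w.1 - f w.2 = D w (w.1 - w.2) := by
  obtain ⟨p, hp⟩ := hf
  obtain ⟨ρ, hρ⟩ := hp
  obtain ⟨r, hr0, hrρ⟩ := ENNReal.lt_iff_exists_nnreal_btwn.1 hρ.r_pos
  have hr : 0 < r := by exact_mod_cast hr0
  obtain ⟨C, hC, hpC⟩ :=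
    p.norm_le_div_pow_of_pos_of_lt_radius hr (hrρ.trans_le hρ.r_le)
  let q : FormalMultilinearSeries 𝕜 (E × E) (E →L[𝕜] F) :=
    fun n => ∑ k, (p (n + 1)).dividedDifferenceTerm k
  have hq (n : ℕ) : ‖q n‖ ≤ (n + 1) * ‖p (n + 1)‖ := by
    refine (norm_sum_le Finset.univ fun k => (p (n + 1)).dividedDifferenceTerm k).trans
      ((Finset.sum_le_sum fun k _ => norm_dividedDifferenceTerm_le (p (n + 1)) k).trans ?_)
    simp
  have hrad : ((r / 2 : NNReal) : ENNReal) ≤ q.radius := by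
    refine q.le_radius_of_bound (C / r) fun n => ?_
    have hr' : (0 : ℝ) < r := hr
    have h2 : ((n : ℝ) + 1) ≤ 2 ^ n := by exact_mod_cast Nat.lt_two_pow_self (n := n)
    calc ‖q n‖ * ((r / 2 : NNReal) : ℝ) ^ n
        ≤ (2 ^ n * (C / (r : ℝ) ^ (n + 1))) * ((r / 2 : NNReal) : ℝ) ^ n := by
          gcongr
          exact (hq n).trans (mul_le_mul h2 (hpC _) (norm_nonneg _) (by positivity))
      _ = C / r := by
          push_cast
          rw [div_pow, pow_succ]
          field_simp
  have hq0 : 0 < q.radius := lt_of_lt_of_le (by simpa using hr.ne') hrad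
  have hqs := q.hasFPowerSeriesOnBall hq0
  refine ⟨fun w => q.sum (w - (x, x)), ?_, ?_⟩
  · have := hqs.comp_sub (x, x)
    rw [zero_add] at this
    exact this.analyticAt
  · have h1 : ∀ᶠ w : E × E in 𝓝 (x, x), w - (x, x) ∈ Metric.eball (0 : E × E) q.radius := by
      have : ContinuousAt (fun w : E × E => w - (x, x)) (x, x) := by fun_prop
      exact this.eventually_mem (by rw [sub_self]; exact Metric.eball_mem_nhds _ hq0)
    have h2 : ∀ᶠ w : E in 𝓝 x, HasSum (fun n => p n fun _ => w - x) (f w) := by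
      filter_upwards [Metric.eball_mem_nhds x hρ.r_pos] with w hw using hρ.hasSum_sub hw
    filter_upwards [h1, (continuousAt_fst (p := (x, x))).eventually h2,
      (continuousAt_snd (p := (x, x))).eventually h2] with w hw ha hb
    have hs := (q.hasSum hw).mapL (ContinuousLinearMap.apply 𝕜 F (w.1 - w.2))
    have hd := (hasSum_nat_add_iff' 1).2 (ha.sub hb)
    refine Eq.trans (by simp [Subsingleton.elim (fun _ : Fin 0 => w.1 - x) fun _ => w.2 - x])
      (hd.unique (hs.congr_fun fun n => ?_))
    have := sum_dividedDifferenceTerm_apply_sub (p (n + 1)) (w.1 - x) (w.2 - x)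
    rw [sub_sub_sub_cancel_right] at this
    exact this.symm
end

section

open Topology Filter Set

theorem iteratedDeriv_pow_mul_zero {𝕜 : Type*} [NontriviallyNormedField 𝕜] [CompleteSpace 𝕜]
    {g : 𝕜 → 𝕜} (hg : AnalyticAt 𝕜 g 0) (n : ℕ) :
    iteratedDeriv n (fun y => y ^ n * g y) 0 = n.factorial * g 0 := by
  induction n generalizing g with
  | zero => simp
  | succ n ih =>
    have h : deriv (fun y => y ^ (n + 1) * g y) =ᶠ[𝓝 0]
        fun y => y ^ n * ((n + 1) * g y + y * deriv g y) := by
      filter_upwards [hg.eventually_analyticAt] with y hy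
      have := ((hasDerivAt_pow (n + 1) y).mul hy.differentiableAt.hasDerivAt).deriv
      refine Eq.trans this ?_
      push_cast [Nat.add_sub_cancel]
      ring
    rw [iteratedDeriv_succ', h.iteratedDeriv_eq, ih (by fun_prop), Nat.factorial_succ]
    push_cast
    ring

theorem AnalyticAt.rpow_const_of_pos {E : Type*} [NormedAddCommGroup E] [NormedSpace ℝ E]
    {g : E → ℝ} {x : E} (hg : AnalyticAt ℝ g x) (hx : 0 < g x) (c : ℝ) :
    AnalyticAt ℝ (fun z => g z ^ c) x := by
  refine AnalyticAt.congr (f := fun z => Real.exp (Real.log (g z) * c)) ?_ ?_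
  · have hlog : AnalyticAt ℝ (fun z => Real.log (g z) * c) x :=
      ((analyticAt_log hx).comp hg).mul analyticAt_const
    exact analyticAt_rexp.comp hlog
  · filter_upwards [hg.continuousAt.eventually_const_lt hx] with z hz
    rw [Real.rpow_def_of_pos hz]

/-- A real analytic function of one variable is, up to an analytic rescaling of the variable,
constant or a signed power near `0`. -/
theorem AnalyticAt.exists_pow_normalForm {φ : ℝ → ℝ} (hφ : AnalyticAt ℝ φ 0) :
    ∃ r : ℝ → ℝ, AnalyticAt ℝ r 0 ∧ 0 < r 0 ∧ ∀ᶠ y in 𝓝 0,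
      ((∀ l : ℕ, 1 ≤ l → iteratedDeriv l φ 0 = 0) → φ y = φ 0) ∧
      ∀ K : ℕ, 1 ≤ K → iteratedDeriv K φ 0 ≠ 0 →
        (∀ l : ℕ, 1 ≤ l → l < K → iteratedDeriv l φ 0 = 0) →
        φ y = φ 0 + Real.sign (iteratedDeriv K φ 0) * (y * r y) ^ K := by
  have hψ : AnalyticAt ℝ (fun y => φ y - φ 0) 0 := hφ.sub analyticAt_const
  have hder {l : ℕ} (hl : 1 ≤ l) : iteratedDeriv l (fun y => φ y - φ 0) 0 = iteratedDeriv l φ 0 := by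
    obtain ⟨k, rfl⟩ := Nat.exists_eq_add_of_le' hl
    rw [iteratedDeriv_succ', iteratedDeriv_succ']
    simp
  rcases h : analyticOrderAt (fun y => φ y - φ 0) 0 with _ | n
  · have h0 := analyticOrderAt_eq_top.1 h
    refine ⟨fun _ => 1, analyticAt_const, one_pos, ?_⟩
    filter_upwards [h0] with y hy
    refine ⟨fun _ => sub_eq_zero.1 hy, fun K hK hKne _ => absurd ?_ hKne⟩
    rw [← hder hK, EventuallyEq.iteratedDeriv_eq K (g := fun _ => 0) h0]
    simp
  · replace h : analyticOrderAt (fun y => φ y - φ 0) 0 = n := h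
    obtain ⟨hlow, hne⟩ := (analyticOrderAt_eq_nat_iff_iteratedDeriv_eq_zero hψ).1 h
    have hn : 1 ≤ n := by
      by_contra! hn
      obtain rfl : n = 0 := by omega
      simp at hne
    obtain ⟨g, hg, hg0, hgeq⟩ := hψ.analyticOrderAt_eq_natCast.1 h
    simp only [sub_zero, smul_eq_mul] at hgeq
    have hval : iteratedDeriv n φ 0 = n.factorial * g 0 := by
      rw [← hder hn, EventuallyEq.iteratedDeriv_eq n hgeq, iteratedDeriv_pow_mul_zero hg]
    have hsign : Real.sign (iteratedDeriv n φ 0) = Real.sign (g 0) := by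
      have : (0 : ℝ) < n.factorial := by exact_mod_cast n.factorial_pos
      rcases hg0.lt_or_gt with h' | h'
      · rw [Real.sign_of_neg h', hval, Real.sign_of_neg (mul_neg_of_pos_of_neg this h')]
      · rw [Real.sign_of_pos h', hval, Real.sign_of_pos (mul_pos this h')]
    have hs : Real.sign (g 0) * Real.sign (g 0) = 1 := by
      rcases hg0.lt_or_gt with h' | h' <;> simp [Real.sign_of_neg, Real.sign_of_pos, h']
    have hpos : 0 < Real.sign (g 0) * g 0 := by
      rcases hg0.lt_or_gt with h' | h' <;> simp [Real.sign_of_neg, Real.sign_of_pos, h']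
    have hsg : AnalyticAt ℝ (fun y => Real.sign (g 0) * g y) 0 := analyticAt_const.mul hg
    refine ⟨fun y => (Real.sign (g 0) * g y) ^ ((n : ℝ)⁻¹), hsg.rpow_const_of_pos hpos _,
      Real.rpow_pos_of_pos hpos _, ?_⟩
    filter_upwards [hgeq, hsg.continuousAt.eventually_const_lt hpos] with y hy hy0
    refine ⟨fun hall => absurd (hall n hn) (by rwa [← hder hn]), fun K hK hKne hKlow => ?_⟩
    obtain rfl : K = n := by
      rcases lt_trichotomy K n with hlt | heq | hgt
      · exact absurd (hder hK ▸ hlow K hlt) hKne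
      · exact heq
      · exact absurd (hKlow n hn hgt) (by rwa [← hder hn])
    rw [hsign, mul_pow, Real.rpow_inv_natCast_pow hy0.le (by omega)]
    linear_combination hy - y ^ K * g y * hs

/-- Inverse function theorem for analytic maps, with the domain of the local inverse shrunk into
a given neighbourhood. -/
theorem AnalyticAt.exists_analytic_localInverse {𝕜 E F : Type*} [RCLike 𝕜]
    [NormedAddCommGroup E] [NormedSpace 𝕜 E] [CompleteSpace E] [NormedAddCommGroup F]
    [NormedSpace 𝕜 F] [CompleteSpace F] {Ψ : E → F} {x : E} (h : AnalyticAt 𝕜 Ψ x)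
    {L : E ≃L[𝕜] F} (hL : HasFDerivAt Ψ (L : E →L[𝕜] F) x) {s : Set E} (hs : s ∈ 𝓝 x) :
    ∃ (V : Set F) (U : Set E) (Φ : F → E), IsOpen V ∧ Ψ x ∈ V ∧ IsOpen U ∧ U ⊆ s ∧ x ∈ U ∧
      Φ (Ψ x) = x ∧ BijOn Φ V U ∧ InvOn Ψ Φ V U ∧ (∀ z ∈ V, AnalyticAt 𝕜 Φ z) ∧
      (∀ w ∈ U, AnalyticAt 𝕜 Ψ w) ∧ HasFDerivAt Φ (L.symm : F →L[𝕜] E) (Ψ x) := by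
  have hst : HasStrictFDerivAt Ψ (L : E →L[𝕜] F) x := hL.fderiv ▸ h.hasStrictFDerivAt
  let e := hst.toOpenPartialHomeomorph Ψ
  have he : ⇑e = Ψ := hst.toOpenPartialHomeomorph_coe
  have hx : x ∈ e.source := hst.mem_toOpenPartialHomeomorph_source
  have hex : e.symm (Ψ x) = x := by rw [← he]; exact e.left_inv hx
  have hsymm : AnalyticAt 𝕜 e.symm (Ψ x) := by
    obtain ⟨p, hp⟩ := h
    have hp1 : p 1 = (continuousMultilinearCurryFin1 𝕜 E F).symm L := by
      rw [← hp.hasStrictFDerivAt.hasFDerivAt.unique hL]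
      simp
    rw [← he] at hp ⊢
    exact (e.hasFPowerSeriesAt_symm hx hp hp1).analyticAt
  let W := interior (s ∩ {w | AnalyticAt 𝕜 Ψ w})
  have hxW : x ∈ W := mem_interior_iff_mem_nhds.2 (inter_mem hs h.eventually_analyticAt)
  let T := {z | AnalyticAt 𝕜 e.symm z}
  have hT : IsOpen T := isOpen_analyticAt 𝕜 _
  have hΨmem {w : E} (hw : w ∈ e.source) : Ψ w ∈ e.target := by
    rw [← he]; exact e.map_source hw
  have hleft {w : E} (hw : w ∈ e.source) : e.symm (Ψ w) = w := by
    rw [← he]; exact e.left_inv hw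
  have hright {z : F} (hz : z ∈ e.target) : Ψ (e.symm z) = z := by
    rw [← he]; exact e.right_inv hz
  have hmaps : MapsTo e.symm (e.target ∩ e.symm ⁻¹' W ∩ T) (e.source ∩ Ψ ⁻¹' T ∩ W) :=
    fun z hz => ⟨⟨e.map_target hz.1.1, by rw [mem_preimage, hright hz.1.1]; exact hz.2⟩, hz.1.2⟩
  have hmaps' : MapsTo Ψ (e.source ∩ Ψ ⁻¹' T ∩ W) (e.target ∩ e.symm ⁻¹' W ∩ T) :=
    fun w hw => ⟨⟨hΨmem hw.1.1, by rw [mem_preimage, hleft hw.1.1]; exact hw.2⟩, hw.1.2⟩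
  have hinv : InvOn Ψ e.symm (e.target ∩ e.symm ⁻¹' W ∩ T) (e.source ∩ Ψ ⁻¹' T ∩ W) :=
    ⟨fun z hz => hright hz.1.1, fun w hw => hleft hw.1.1⟩
  refine ⟨e.target ∩ e.symm ⁻¹' W ∩ T, e.source ∩ Ψ ⁻¹' T ∩ W, e.symm, ?_, ?_, ?_, ?_, ?_, hex,
    hinv.bijOn hmaps hmaps', hinv, fun z hz => hz.2, fun w hw => (interior_subset hw.2).2, ?_⟩
  · exact (e.symm.isOpen_inter_preimage isOpen_interior).inter hT
  · exact ⟨⟨hΨmem hx, by rwa [mem_preimage, hex]⟩, hsymm⟩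
  · rw [← he]
    exact (e.isOpen_inter_preimage hT).inter isOpen_interior
  · exact fun w hw => (interior_subset hw.2).1
  · exact ⟨⟨hx, hsymm⟩, hxW⟩
  · rw [← he]
    refine e.hasFDerivAt_symm (e.map_source hx) ?_
    rw [e.left_inv hx, he]
    exact hL

/-- The real-linear map of `ℂ` with diagonal matrix `diag (a, b)` in the basis `1, I`. -/
noncomputable def Complex.diagCLM (a b : ℝ) : ℂ →L[ℝ] ℂ :=
  reCLM.smulRight (a : ℂ) + imCLM.smulRight (b * I)

theorem Complex.diagCLM_apply (a b : ℝ) (v : ℂ) :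
    diagCLM a b v = (v.re : ℂ) * a + (v.im : ℂ) * (b * I) := by
  simp [diagCLM]

/-- The map `Complex.diagCLM a b` as an equivalence, for nonzero `a` and `b`. -/
noncomputable def Complex.diagCLE {a b : ℝ} (ha : a ≠ 0) (hb : b ≠ 0) : ℂ ≃L[ℝ] ℂ :=
  ContinuousLinearEquiv.equivOfInverse (diagCLM a b) (diagCLM a⁻¹ b⁻¹)
    (fun v => by apply Complex.ext <;> simp [diagCLM_apply, ha, hb])
    (fun v => by apply Complex.ext <;> simp [diagCLM_apply, ha, hb])

/-- The increment of an analytic function on `ℂ` from the imaginary axis is divisible by `re`. -/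
theorem AnalyticAt.exists_sub_eq_re_mul {h : ℂ → ℝ} (hh : AnalyticAt ℝ h 0) :
    ∃ g : ℂ → ℝ, AnalyticAt ℝ g 0 ∧ ∀ᶠ z in 𝓝 0, h z - h (I * z.im) = z.re * g z := by
  obtain ⟨D, hD, hDeq⟩ := hh.exists_dividedDifference
  let j : ℂ →L[ℝ] ℂ × ℂ := (ContinuousLinearMap.id ℝ ℂ).prod (diagCLM 0 1)
  have hj (z : ℂ) : j z = (z, I * z.im) := by
    simp [j, diagCLM_apply, mul_comm]
  have hj0 : j 0 = (0, 0) := map_zero j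
  refine ⟨fun z => D (j z) 1, ?_, ?_⟩
  · have : AnalyticAt ℝ (fun z => D (j z)) 0 :=
      AnalyticAt.comp (f := j) (by rwa [hj0]) (j.analyticAt 0)
    exact ((ContinuousLinearMap.apply ℝ ℝ (1 : ℂ)).analyticAt _).comp this
  · have hjt : Tendsto j (𝓝 0) (𝓝 (0, 0)) := hj0 ▸ j.continuous.tendsto 0
    filter_upwards [hjt.eventually hDeq] with z hz
    rw [hj] at hz
    have hsub : z - I * z.im = z.re • (1 : ℂ) := by
      apply Complex.ext <;> simp
    rw [hj, hz, hsub, map_smul, smul_eq_mul]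

/-- The increment from the imaginary axis of an analytic function even in `re` is divisible by
`re ^ 2`. -/
theorem AnalyticAt.exists_eq_add_re_sq_mul {f : ℂ → ℝ} (hf : AnalyticAt ℝ f 0)
    (hsym : ∀ᶠ z in 𝓝 0, f z = f (-(starRingEnd ℂ z))) :
    ∃ g : ℂ → ℝ, AnalyticAt ℝ g 0 ∧ ∀ᶠ z in 𝓝 0, f z = f (I * z.im) + z.re ^ 2 * g z := by
  obtain ⟨u, hu, hueq⟩ := hf.exists_sub_eq_re_mul
  let σ : ℂ →L[ℝ] ℂ := diagCLM (-1) 1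
  have hσ (z : ℂ) : σ z = -(starRingEnd ℂ z) := by
    apply Complex.ext <;> simp [σ, diagCLM_apply]
  have hσ0 : σ 0 = 0 := map_zero σ
  have huσ : AnalyticAt ℝ (fun z => u (σ z)) 0 :=
    AnalyticAt.comp (f := σ) (by rwa [hσ0]) (σ.analyticAt 0)
  have hodd : AnalyticAt ℝ (fun z => (1 / 2 : ℝ) * (u z - u (σ z))) 0 :=
    analyticAt_const.mul (hu.sub huσ)
  obtain ⟨g, hg, hgeq⟩ := hodd.exists_sub_eq_re_mul
  have hσt : Tendsto σ (𝓝 0) (𝓝 0) := by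
    simpa [hσ0] using σ.continuous.tendsto 0
  refine ⟨g, hg, ?_⟩
  filter_upwards [hsym, hueq, hσt.eventually hueq, hgeq] with z hs h1 h2 h3
  have hI : σ (I * z.im) = I * z.im := by
    apply Complex.ext <;> simp [hσ]
  rw [hI, sub_self, mul_zero, sub_zero] at h3
  have him : (σ z).im = z.im := by simp [hσ]
  have hre : (σ z).re = -z.re := by simp [hσ]
  rw [him, hre, hσ, ← hs, ← hσ] at h2
  linear_combination z.re * h3 + (1 / 2) * h1 + (1 / 2) * h2

theorem fderiv_fderiv_one_one_of_eq_add_re_sq_mul {f g : ℂ → ℝ} (hf : AnalyticAt ℝ f 0)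
    (hg : AnalyticAt ℝ g 0) (hfg : ∀ᶠ z in 𝓝 0, f z = f (I * z.im) + z.re ^ 2 * g z) :
    fderiv ℝ (fun z => fderiv ℝ f z 1) 0 1 = 2 * g 0 := by
  let π : ℂ →L[ℝ] ℂ := diagCLM 0 1
  have hπ (z : ℂ) : π z = I * z.im := by
    simp [π, diagCLM_apply, mul_comm]
  have hπt : Tendsto π (𝓝 0) (𝓝 0) := by
    simpa using π.continuous.tendsto 0
  let m : ℂ → ℝ := fun z => 2 * g z + reCLM z * fderiv ℝ g z 1
  have hm : AnalyticAt ℝ m 0 :=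
    (analyticAt_const.mul hg).add ((reCLM.analyticAt 0).mul
      (((ContinuousLinearMap.apply ℝ ℝ (1 : ℂ)).analyticAt _).comp hg.fderiv))
  have hfirst : (fun z => fderiv ℝ f z 1) =ᶠ[𝓝 0] fun z => reCLM z * m z := by
    filter_upwards [hfg.eventually_nhds, hπt.eventually hf.eventually_analyticAt,
      hg.eventually_analyticAt] with z hz hfz hgz
    have hEq : f =ᶠ[𝓝 z] fun w => f (π w) + reCLM w ^ 2 * g w := by
      filter_upwards [hz] with w hw
      rw [hw, hπ]
      simp
    have h1 : HasFDerivAt (fun w => f (π w)) ((fderiv ℝ f (π z)).comp π) z :=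
      hfz.differentiableAt.hasFDerivAt.comp z π.hasFDerivAt
    have h2 := h1.add ((reCLM.hasFDerivAt.pow 2).mul hgz.differentiableAt.hasFDerivAt)
    rw [(h2.congr_of_eventuallyEq hEq).fderiv]
    simp [hπ, m]
    ring
  have hmul : HasFDerivAt (fun z => reCLM z * m z) _ 0 :=
    reCLM.hasFDerivAt.mul hm.differentiableAt.hasFDerivAt
  rw [hfirst.fderiv_eq, hmul.fderiv]
  simp [m]

end

open Topology Filter in
/-- **Higher order Morse lemma with symmetry.** Let `f` be real analytic near `0 ∈ ℂ`
with `∂ₓf(0) = ∂_yf(0) = 0`, `Δf(0) > 0`, `∂ₓ²f(0) > 0`, and with the symmetry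
`f(ζ) = f(−conj ζ)`. Then the normalizing diffeomorphism can be chosen with positive
diagonal derivative at `0`, the exponent `K` being the order of the first nonvanishing
derivative of `t ↦ f(i t)` at `0` and the sign `τ` being its sign (with normal form
`f(0) + x²` if all these derivatives vanish). -/
theorem higher_order_morse_lemma_with_symmetry (U : Set ℂ) (hU : IsOpen U)
    (hU0 : (0 : ℂ) ∈ U) (f : ℂ → ℝ) (hf : ∀ z ∈ U, AnalyticAt ℝ f z)
    (hfx : fderiv ℝ f 0 1 = 0) (hfy : fderiv ℝ f 0 Complex.I = 0)
    (hΔ : 0 < fderiv ℝ (fun z => fderiv ℝ f z 1) 0 1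
        + fderiv ℝ (fun z => fderiv ℝ f z Complex.I) 0 Complex.I)
    (hxx : 0 < fderiv ℝ (fun z => fderiv ℝ f z 1) 0 1)
    (hsym : ∀ ζ ∈ U, -(starRingEnd ℂ ζ) ∈ U → f ζ = f (-(starRingEnd ℂ ζ))) :
    ∃ (V U₀ : Set ℂ) (Φ Ψ : ℂ → ℂ) (α β : ℝ),
      IsOpen V ∧ (0 : ℂ) ∈ V ∧ IsOpen U₀ ∧ U₀ ⊆ U ∧ (0 : ℂ) ∈ U₀ ∧ Φ 0 = 0 ∧
      Set.BijOn Φ V U₀ ∧ (∀ z ∈ V, AnalyticAt ℝ Φ z) ∧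
      Set.InvOn Ψ Φ V U₀ ∧ (∀ w ∈ U₀, AnalyticAt ℝ Ψ w) ∧
      0 < α ∧ 0 < β ∧
      fderiv ℝ Φ 0 1 = (α : ℂ) ∧ fderiv ℝ Φ 0 Complex.I = (β : ℂ) * Complex.I ∧
      ((∀ l : ℕ, 1 ≤ l →
          iteratedDeriv l (fun t : ℝ => f (Complex.I * (t : ℂ))) 0 = 0) →
        ∀ z ∈ V, f (Φ z) = f 0 + z.re ^ 2) ∧
      ∀ K : ℕ, 1 ≤ K →
        iteratedDeriv K (fun t : ℝ => f (Complex.I * (t : ℂ))) 0 ≠ 0 →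
        (∀ l : ℕ, 1 ≤ l → l < K →
          iteratedDeriv l (fun t : ℝ => f (Complex.I * (t : ℂ))) 0 = 0) →
        ∀ z ∈ V, f (Φ z) = f 0 + z.re ^ 2
          + Real.sign (iteratedDeriv K (fun t : ℝ => f (Complex.I * (t : ℂ))) 0)
            * z.im ^ K := by
  have hf0 : AnalyticAt ℝ f 0 := hf 0 hU0
  have hconj : Tendsto (fun z : ℂ => -(starRingEnd ℂ z)) (𝓝 0) (𝓝 0) := by
    have : Continuous fun z : ℂ => -(starRingEnd ℂ z) := by fun_prop
    simpa using this.tendsto 0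
  have hev : ∀ᶠ z in 𝓝 (0 : ℂ), f z = f (-(starRingEnd ℂ z)) := by
    filter_upwards [hU.mem_nhds hU0, hconj.eventually (hU.mem_nhds hU0)] with z h1 h2
    exact hsym z h1 h2
  obtain ⟨g, hg, hfg⟩ := hf0.exists_eq_add_re_sq_mul hev
  have hg0 : 0 < g 0 := by
    rw [fderiv_fderiv_one_one_of_eq_add_re_sq_mul hf0 hg hfg] at hxx
    linarith
  have haxis : AnalyticAt ℝ (fun t : ℝ => f (I * (t : ℂ))) 0 := by
    have h : AnalyticAt ℝ (fun t : ℝ => I * (t : ℂ)) 0 :=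
      analyticAt_const.mul (ofRealCLM.analyticAt 0)
    exact AnalyticAt.comp (f := fun t : ℝ => I * (t : ℂ)) (by simpa using hf0) h
  obtain ⟨r, hr, hr0, hrnf⟩ := haxis.exists_pow_normalForm
  simp only [ofReal_zero, mul_zero] at hrnf
  let u : ℂ → ℝ := fun z => g z ^ (2⁻¹ : ℝ)
  have hu : AnalyticAt ℝ u 0 := hg.rpow_const_of_pos hg0 _
  have hu0 : 0 < u 0 := Real.rpow_pos_of_pos hg0 _
  have hrim : AnalyticAt ℝ (fun z : ℂ => r (imCLM z)) 0 :=
    AnalyticAt.comp (f := imCLM) (by simpa using hr) (imCLM.analyticAt 0)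
  let Ψ : ℂ → ℂ := fun z =>
    ((reCLM z * u z : ℝ) : ℂ) + ((imCLM z * r (imCLM z) : ℝ) : ℂ) * I
  have hΨre (z : ℂ) : (Ψ z).re = z.re * u z := by simp [Ψ]
  have hΨim (z : ℂ) : (Ψ z).im = z.im * r z.im := by simp [Ψ]
  have hΨ0 : Ψ 0 = 0 := by simp [Ψ]
  have hΨ : AnalyticAt ℝ Ψ 0 :=
    ((ofRealCLM.analyticAt _).comp ((reCLM.analyticAt 0).mul hu)).add
      (((ofRealCLM.analyticAt _).comp ((imCLM.analyticAt 0).mul hrim)).mul analyticAt_const)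
  have hΨ' : HasFDerivAt Ψ (diagCLE hu0.ne' hr0.ne' : ℂ →L[ℝ] ℂ) 0 := by
    have h1 := ofRealCLM.hasFDerivAt.comp (0 : ℂ)
      (reCLM.hasFDerivAt.mul hu.differentiableAt.hasFDerivAt)
    have h2 := (ofRealCLM.hasFDerivAt.comp (0 : ℂ)
      (imCLM.hasFDerivAt.mul hrim.differentiableAt.hasFDerivAt)).mul_const I
    refine (h1.add h2).congr_fderiv ?_
    ext v
    simp [diagCLE, diagCLM_apply]
    ring
  have him : Tendsto Complex.im (𝓝 0) (𝓝 0) := by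
    simpa using Complex.continuous_im.tendsto 0
  obtain ⟨V, U₀, Φ, hV, hV0, hU₀, hU₀s, hU₀0, hΦ0, hbij, hinv, hΦan, hΨan, hΦ'⟩ :=
    hΨ.exists_analytic_localInverse hΨ' (inter_mem (hU.mem_nhds hU0) (inter_mem hfg
      (inter_mem (hg.continuousAt.eventually_const_lt hg0) (him.eventually hrnf))))
  rw [hΨ0] at hV0 hΦ0 hΦ'
  have hsq {z : ℂ} (hz : z ∈ V) : f (Φ z) = f (I * (Φ z).im) + z.re ^ 2 := by
    obtain ⟨_, h1, h2, _⟩ := hU₀s (hbij.mapsTo hz)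
    have hre : z.re = (Φ z).re * u (Φ z) := by rw [← hΨre, hinv.1 hz]
    have hpos : 0 < g (Φ z) := h2
    have husq : u (Φ z) ^ 2 = g (Φ z) := by
      exact_mod_cast Real.rpow_inv_natCast_pow hpos.le two_ne_zero
    rw [hre, mul_pow, husq]
    exact h1
  have hzim {z : ℂ} (hz : z ∈ V) : z.im = (Φ z).im * r (Φ z).im := by
    rw [← hΨim, hinv.1 hz]
  refine ⟨V, U₀, Φ, Ψ, (u 0)⁻¹, (r 0)⁻¹, hV, hV0, hU₀, fun w hw => (hU₀s hw).1, hU₀0, hΦ0, hbij,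
    hΦan, hinv, hΨan, inv_pos.2 hu0, inv_pos.2 hr0, ?_, ?_, ?_, ?_⟩
  · rw [hΦ'.fderiv]
    exact (diagCLM_apply _ _ _).trans (by simp)
  · rw [hΦ'.fderiv]
    exact (diagCLM_apply _ _ _).trans (by simp)
  · intro hall z hz
    obtain ⟨_, _, _, h3, _⟩ := hU₀s (hbij.mapsTo hz)
    rw [hsq hz, h3 hall]
  · intro K hK hne hlow z hz
    obtain ⟨_, _, _, _, h4⟩ := hU₀s (hbij.mapsTo hz)
    rw [hsq hz, h4 K hK hne hlow, hzim hz]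
    ring
end

section
/- Discrete truncated moment problem, even case: For every natural number n ≥ 1 and every τ ∈ {−1, 1}, there exist positive real numbers c₁, …, c_n > 0 and pairwise distinct complex numbers z₁, …, z_n ∈ ℂ_> such that Re(Σ_{i=1}^n c_i·z_i^{2n+1}) = τ and Re(Σ_{i=1}^n c_i·z_i^{2k+1}) = 0 for every integer k with 1 ≤ k ≤ n − 1. -/
open Complex

/-- The `j`-th node `(2j+1)π/(4N)` of the discrete cosine transform of type IV of length `N`. -/
noncomputable def dctNode (N j : ℕ) : ℝ := (2 * j + 1) * Real.pi / (4 * N)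

theorem sum_cos_odd_mul_two_sin (N : ℕ) (x : ℝ) :
    (∑ j ∈ Finset.range N, Real.cos ((2 * j + 1) * x)) * (2 * Real.sin x) =
      Real.sin (2 * N * x) := by
  induction N with
  | zero => simp
  | succ N ih =>
    rw [Finset.sum_range_succ, add_mul, ih]
    have h₁ : Real.sin (2 * (N + 1 : ℕ) * x) = Real.sin ((2 * N + 1) * x + x) := by
      push_cast; ring_nf
    have h₂ : Real.sin (2 * N * x) = Real.sin ((2 * N + 1) * x - x) := by ring_nf
    rw [h₁, h₂, Real.sin_add, Real.sin_sub]
    ring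

theorem sum_cos_even_mul_dctNode {N m : ℕ} (hm : 0 < m) (hmN : m < 2 * N) :
    ∑ j ∈ Finset.range N, Real.cos (2 * m * dctNode N j) = 0 := by
  have hN : (0 : ℝ) < N := by exact_mod_cast (by omega : 0 < N)
  have hm' : (0 : ℝ) < m := by exact_mod_cast hm
  have hmN' : (m : ℝ) < 2 * N := by exact_mod_cast hmN
  have key := sum_cos_odd_mul_two_sin N (m * Real.pi / (2 * N))
  have hsin : 0 < Real.sin (m * Real.pi / (2 * N)) := by
    apply Real.sin_pos_of_pos_of_lt_pi
    · positivity
    · rw [div_lt_iff₀ (by positivity)]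
      nlinarith [Real.pi_pos]
  rw [show 2 * (N : ℝ) * (m * Real.pi / (2 * N)) = m * Real.pi by field_simp,
    Real.sin_nat_mul_pi] at key
  rw [← (mul_eq_zero.mp key).resolve_right (by positivity)]
  refine Finset.sum_congr rfl fun j _ => ?_
  congr 1
  unfold dctNode
  field_simp
  ring

theorem sum_cos_odd_mul_cos_odd_dctNode {N k l : ℕ} (hlk : l < k) (hk : k < N) :
    ∑ j ∈ Finset.range N,
      Real.cos ((2 * k + 1 : ℕ) * dctNode N j) * Real.cos ((2 * l + 1 : ℕ) * dctNode N j) = 0 := by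
  have h₁ := sum_cos_even_mul_dctNode (N := N) (m := k - l) (by omega) (by omega)
  have h₂ := sum_cos_even_mul_dctNode (N := N) (m := k + l + 1) (by omega) (by omega)
  rw [← mul_right_inj' (two_ne_zero' ℝ), mul_zero, ← add_zero (0 : ℝ)]
  nth_rw 1 [← h₁]
  rw [← h₂, ← Finset.sum_add_distrib, Finset.mul_sum]
  refine Finset.sum_congr rfl fun j _ => ?_
  rw [← mul_assoc, Real.two_mul_cos_mul_cos]
  push_cast [Nat.cast_sub hlk.le]
  ring_nf

theorem sum_cos_odd_sq_dctNode {N k : ℕ} (hk : k < N) :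
    ∑ j ∈ Finset.range N,
      Real.cos ((2 * k + 1 : ℕ) * dctNode N j) * Real.cos ((2 * k + 1 : ℕ) * dctNode N j) =
        N / 2 := by
  have h := sum_cos_even_mul_dctNode (N := N) (m := 2 * k + 1) (by omega) (by omega)
  rw [← mul_right_inj' (two_ne_zero' ℝ), Finset.mul_sum]
  trans ∑ j ∈ Finset.range N, (1 + Real.cos (2 * (2 * k + 1 : ℕ) * dctNode N j))
  · refine Finset.sum_congr rfl fun j _ => ?_
    rw [mul_assoc 2, Real.cos_two_mul]
    ring
  · rw [Finset.sum_add_distrib, h]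
    simp
    ring

theorem cos_top_mul_dctNode (n j : ℕ) :
    Real.cos ((2 * n + 1 : ℕ) * dctNode (n + 1) j) =
      (-1) ^ j * Real.sin (dctNode (n + 1) j) := by
  have h : ((2 * n + 1 : ℕ) : ℝ) * dctNode (n + 1) j =
      j * Real.pi - (dctNode (n + 1) j - Real.pi / 2) := by
    unfold dctNode
    push_cast
    field_simp
    ring
  rw [h, Real.cos_sub, Real.sin_nat_mul_pi, Real.cos_nat_mul_pi, Real.cos_sub_pi_div_two]
  ring

theorem dctNode_mem_Ioo {N j : ℕ} (hj : j < N) :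
    dctNode N j ∈ Set.Ioo 0 (Real.pi / 2) := by
  have hN : (0 : ℝ) < N := by exact_mod_cast (by omega : 0 < N)
  have hj' : (j : ℝ) + 1 ≤ N := by exact_mod_cast hj
  have := Real.pi_pos
  unfold dctNode
  refine ⟨by positivity, ?_⟩
  rw [div_lt_iff₀ (by positivity)]
  nlinarith

theorem dctNode_strictMono {N : ℕ} (hN : 0 < N) : StrictMono (dctNode N) := by
  intro i j hij
  have hN' : (0 : ℝ) < N := by exact_mod_cast hN
  have hij' : (i : ℝ) < j := by exact_mod_cast hij
  have := Real.pi_pos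
  unfold dctNode
  gcongr

/-- For `τ = ±1`, the combination `tan θₘ cos θⱼ + τ (-1)ʲ sin θⱼ` is positive at every node other
than the last node `θₘ` at which `τ (-1)ᵐ = -1`. -/
theorem dctNode_weight_pos {n m j : ℕ} {τ : ℝ} (hτ : τ = 1 ∨ τ = -1) (hm : m ≤ n)
    (hnm : n ≤ m + 1) (hsign : τ * (-1) ^ m = -1) (hj : j ≤ n) (hjm : j ≠ m) :
    0 < Real.tan (dctNode (n + 1) m) * Real.cos (dctNode (n + 1) j) +
      τ * ((-1) ^ j * Real.sin (dctNode (n + 1) j)) := by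
  obtain ⟨hj0, hj1⟩ := dctNode_mem_Ioo (N := n + 1) (j := j) (by omega)
  obtain ⟨hm0, hm1⟩ := dctNode_mem_Ioo (N := n + 1) (j := m) (by omega)
  have hcos : 0 < Real.cos (dctNode (n + 1) j) :=
    Real.cos_pos_of_mem_Ioo ⟨by linarith, hj1⟩
  have hsin : 0 < Real.sin (dctNode (n + 1) j) :=
    Real.sin_pos_of_pos_of_lt_pi hj0 (by linarith)
  have htan : 0 < Real.tan (dctNode (n + 1) m) := Real.tan_pos_of_pos_of_lt_pi_div_two hm0 hm1
  rw [← mul_assoc]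
  have hcase : τ * (-1) ^ j = 1 ∨ τ * (-1) ^ j = -1 := by
    rcases hτ with rfl | rfl <;> rcases neg_one_pow_eq_or ℝ j with h | h <;> simp [h]
  rcases hcase with h | h
  · rw [h]
    positivity
  · have hlt : j < m := by
      refine lt_of_le_of_ne ?_ hjm
      by_contra hlt
      obtain rfl : j = m + 1 := by omega
      rw [pow_succ] at h
      linarith
    have := Real.tan_lt_tan_of_lt_of_lt_pi_div_two (by linarith) hm1
      (dctNode_strictMono (Nat.succ_pos n) hlt)
    rw [Real.tan_eq_sin_div_cos (dctNode (n + 1) j), div_lt_iff₀ hcos] at this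
    rw [h]
    linarith

/-- **Discrete truncated moment problem, even case.** For every `n ≥ 1` and
`τ ∈ {−1, 1}` there exist positive weights `c₁, …, c_n` and pairwise distinct points
`z₁, …, z_n` in the open first quadrant such that `Re Σ c_i z_i^{2n+1} = τ` and
`Re Σ c_i z_i^{2k+1} = 0` for `1 ≤ k ≤ n − 1`. -/
theorem discrete_moment_problem_even (n : ℕ) (hn : 1 ≤ n) (τ : ℝ)
    (hτ : τ = 1 ∨ τ = -1) :
    ∃ (c : Fin n → ℝ) (z : Fin n → ℂ),
      (∀ i, 0 < c i) ∧ Function.Injective z ∧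
      (∀ i, 0 < (z i).re ∧ 0 < (z i).im) ∧
      (∑ i, (c i : ℂ) * z i ^ (2 * n + 1)).re = τ ∧
      ∀ k : ℕ, 1 ≤ k → k < n → (∑ i, (c i : ℂ) * z i ^ (2 * k + 1)).re = 0 := by
  obtain ⟨m, hm, hnm, hsign⟩ : ∃ m, m ≤ n ∧ n ≤ m + 1 ∧ τ * (-1) ^ m = -1 := by
    obtain ⟨p, rfl⟩ : ∃ p, n = p + 1 := ⟨n - 1, by omega⟩
    by_cases h : τ * (-1) ^ p = -1
    · exact ⟨p, by omega, by omega, h⟩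
    · refine ⟨p + 1, le_rfl, by omega, ?_⟩
      rcases hτ with rfl | rfl <;> rcases neg_one_pow_eq_or ℝ p with h' | h' <;>
        simp_all [pow_succ]
  set θ := dctNode (n + 1) with hθ
  set w : ℕ → ℝ := fun j => 2 / (n + 1 : ℕ) *
    (Real.tan (θ m) * Real.cos (θ j) + τ * Real.cos ((2 * n + 1 : ℕ) * θ j)) with hw
  have hwm : w m = 0 := by
    obtain ⟨hm0, hm1⟩ := dctNode_mem_Ioo (N := n + 1) (j := m) (by omega)
    have hcos : Real.cos (θ m) ≠ 0 := (Real.cos_pos_of_mem_Ioo ⟨by linarith, hm1⟩).ne'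
    simp only [hw]
    rw [Real.tan_mul_cos hcos, hθ, cos_top_mul_dctNode, ← mul_assoc τ, hsign]
    ring
  let e : Fin n → Fin (n + 1) := Fin.succAbove ⟨m, by omega⟩
  have hem (i : Fin n) : (e i : ℕ) ≠ m := fun h => Fin.succAbove_ne ⟨m, by omega⟩ i (Fin.ext h)
  have hθe (i : Fin n) := dctNode_mem_Ioo (e i).isLt
  have hre (k : ℕ) : (∑ i, (w (e i) : ℂ) * exp (θ (e i) * I) ^ (2 * k + 1)).re =
      ∑ j ∈ Finset.range (n + 1), w j * Real.cos ((2 * k + 1 : ℕ) * θ j) := by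
    rw [← Fin.sum_univ_eq_sum_range (fun j => w j * Real.cos ((2 * k + 1 : ℕ) * θ j)),
      Fin.sum_univ_succAbove _ ⟨m, by omega⟩, hwm, zero_mul, zero_add, Complex.re_sum]
    refine Finset.sum_congr rfl fun i _ => ?_
    rw [Complex.re_ofReal_mul, ← Complex.exp_nat_mul, ← mul_assoc, ← ofReal_natCast,
      ← ofReal_mul, exp_ofReal_mul_I_re]
  have hmoment (k : ℕ) : ∑ j ∈ Finset.range (n + 1), w j * Real.cos ((2 * k + 1 : ℕ) * θ j) =
      2 / (n + 1 : ℕ) *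
        (Real.tan (θ m) * ∑ j ∈ Finset.range (n + 1),
            Real.cos ((2 * k + 1 : ℕ) * θ j) * Real.cos ((2 * 0 + 1 : ℕ) * θ j) +
          τ * ∑ j ∈ Finset.range (n + 1),
            Real.cos ((2 * n + 1 : ℕ) * θ j) * Real.cos ((2 * k + 1 : ℕ) * θ j)) := by
    rw [Finset.mul_sum, Finset.mul_sum, ← Finset.sum_add_distrib, Finset.mul_sum]
    refine Finset.sum_congr rfl fun j _ => ?_
    simp only [hw, mul_zero, zero_add, Nat.cast_one, one_mul]
    ring
  refine ⟨fun i => w (e i), fun i => exp (θ (e i) * I), fun i => ?_, fun i j hij => ?_,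
    fun i => ?_, ?_, fun k hk hkn => ?_⟩
  · simp only [hw]
    rw [hθ, cos_top_mul_dctNode]
    exact mul_pos (by positivity) (dctNode_weight_pos hτ hm hnm hsign (by omega) (hem i))
  · have hcos := congrArg Complex.re hij
    simp only [exp_ofReal_mul_I_re] at hcos
    have hπ := Real.pi_pos
    have := Real.injOn_cos ⟨(hθe i).1.le, by linarith [(hθe i).2]⟩
      ⟨(hθe j).1.le, by linarith [(hθe j).2]⟩ hcos
    exact Fin.succAbove_right_injective
      (Fin.ext ((dctNode_strictMono (Nat.succ_pos n)).injective this))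
  · have hπ := Real.pi_pos
    rw [exp_ofReal_mul_I_re, exp_ofReal_mul_I_im]
    exact ⟨Real.cos_pos_of_mem_Ioo ⟨by linarith [(hθe i).1], (hθe i).2⟩,
      Real.sin_pos_of_pos_of_lt_pi (hθe i).1 (by linarith [(hθe i).2])⟩
  · rw [hre, hmoment, sum_cos_odd_mul_cos_odd_dctNode (by omega) (by omega),
      sum_cos_odd_sq_dctNode (by omega)]
    field_simp
    ring
  · rw [hre, hmoment, sum_cos_odd_mul_cos_odd_dctNode (by omega) (by omega),
      sum_cos_odd_mul_cos_odd_dctNode hkn (by omega)]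
    ring
end

section
/- Discrete truncated moment problem, odd case: For every natural number n ≥ 1, there exist positive real numbers c₁, …, c_{2n+2} > 0 and pairwise distinct complex numbers z₁, …, z_{2n+2} ∈ ℂ_> such that (−1)^{k+1}·Im(Σ_{i=1}^{2n+2} c_i·z_i^{2k}) = 2k and (−1)^{k+1}·Re(Σ_{i=1}^{2n+2} c_i·z_i^{2k+1}) = 2k + 1 for every integer k with 1 ≤ k ≤ n, and in addition (−1)^n·Im(Σ_{i=1}^{2n+2} c_i·z_i^{2(n+1)}) < 2(n + 1). -/
open Complex

/-- Some angle of the open third quadrant has `sin (mθ) > 0` and `sin ((m + 1)θ) < 0`. -/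
lemma exists_angle_third_quadrant (m : ℕ) (hm : 2 ≤ m) :
    ∃ θ : ℝ, Real.cos θ < 0 ∧ Real.sin θ < 0 ∧ 0 < Real.sin (m * θ) ∧
      Real.sin ((m + 1 : ℕ) * θ) < 0 := by
  have hπ := Real.pi_pos
  have hm0 : (0 : ℝ) < m := by positivity
  have hshift (k : ℕ) (φ : ℝ) : Real.sin (k * (φ + Real.pi)) = (-1) ^ k * Real.sin (k * φ) := by
    rw [mul_add, Real.sin_add_nat_mul_pi]
  suffices h : ∃ φ : ℝ, 0 < φ ∧ φ < Real.pi / 2 ∧ 0 < (-1) ^ m * Real.sin (m * φ) ∧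
      0 < (-1) ^ m * Real.sin ((m + 1 : ℕ) * φ) by
    obtain ⟨φ, h0, h1, h2, h3⟩ := h
    refine ⟨φ + Real.pi, ?_, ?_, ?_, ?_⟩
    · rw [Real.cos_add_pi]
      linarith [Real.cos_pos_of_mem_Ioo (x := φ) ⟨by linarith, h1⟩]
    · rw [Real.sin_add_pi]
      linarith [Real.sin_pos_of_pos_of_lt_pi h0 (by linarith)]
    · rwa [hshift]
    · rw [hshift, pow_succ]
      linarith
  rcases Nat.even_or_odd m with he | ho
  · have hm2 : (2 : ℝ) ≤ m := by exact_mod_cast hm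
    have e : (m : ℝ) * (Real.pi / (2 * m)) = Real.pi / 2 := by field_simp
    have hb : Real.pi / (2 * m) ≤ Real.pi / 4 := by gcongr; linarith
    have hp : 0 < Real.pi / (2 * m) := by positivity
    refine ⟨Real.pi / (2 * m), hp, by linarith, ?_, ?_⟩
    · rw [he.neg_one_pow, e]
      simp
    · rw [he.neg_one_pow, one_mul]
      push_cast
      rw [add_mul, e, one_mul]
      exact Real.sin_pos_of_pos_of_lt_pi (by positivity) (by linarith)
  · have hm3 : (3 : ℝ) ≤ m := by
      have : 3 ≤ m := by rcases ho with ⟨j, rfl⟩; omega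
      exact_mod_cast this
    have e : (m : ℝ) * (5 * Real.pi / (4 * m)) = 5 * Real.pi / 4 := by field_simp
    have hb : 5 * Real.pi / (4 * m) ≤ 5 * Real.pi / 12 := by gcongr; linarith
    have hp : 0 < 5 * Real.pi / (4 * m) := by positivity
    have hneg (x : ℝ) (h1 : Real.pi < x) (h2 : x < 2 * Real.pi) : 0 < (-1) * Real.sin x := by
      have := Real.sin_pos_of_pos_of_lt_pi (x := x - Real.pi) (by linarith) (by linarith)
      rw [Real.sin_sub_pi] at this
      linarith
    refine ⟨5 * Real.pi / (4 * m), hp, by linarith, ?_, ?_⟩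
    · rw [ho.neg_one_pow, e]
      exact hneg _ (by linarith) (by linarith)
    · rw [ho.neg_one_pow]
      push_cast
      rw [add_mul, e, one_mul]
      exact hneg _ (by linarith) (by linarith)

lemma im_ofReal_mul_exp_pow (r θ : ℝ) (k : ℕ) :
    (((r : ℂ) * exp (θ * I)) ^ k).im = r ^ k * Real.sin (k * θ) := by
  rw [mul_pow, ← Complex.exp_nat_mul, ← ofReal_pow, im_ofReal_mul, ← mul_assoc]
  congr 1
  rw [← Complex.exp_ofReal_mul_I_im]
  push_cast
  rfl

/-- The matrix of the imaginary parts of the powers `v i ^ (j + 2)`. -/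
def imPowMatrix {D : ℕ} (v : Fin D → ℂ) : Matrix (Fin D) (Fin D) ℝ :=
  Matrix.of fun j i => (v i ^ (j.val + 2)).im

/-- Prescribed values of the moments `∑ cᵢ Im vᵢ ^ (j + 2)`, `j < D`, are attained by `D` points of
the open third quadrant, with the next moment below any prescribed bound. -/
lemma exists_third_quadrant_moments (y : ℕ → ℝ) (hy : 0 < y 0) (D : ℕ) :
    ∃ (c : Fin D → ℝ) (v : Fin D → ℂ), (∀ i, 0 < c i) ∧ (∀ i, (v i).re < 0 ∧ (v i).im < 0) ∧
      (imPowMatrix v).det ≠ 0 ∧ (∀ j < D, ∑ i, c i * (v i ^ (j + 2)).im = y j) ∧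
      ∑ i, c i * (v i ^ (D + 2)).im < y D := by
  induction D with
  | zero => exact ⟨0, 0, by simp, by simp, by simp, by simp, by simpa⟩
  | succ D ih =>
    obtain ⟨c, v, hc, hv, hdet, hmom, hlast⟩ := ih
    obtain ⟨θ, hcos, hsin, hs, hs'⟩ := exists_angle_third_quadrant (D + 2) (by omega)
    set s := Real.sin ((D + 2 : ℕ) * θ)
    set s' := Real.sin ((D + 2 + 1 : ℕ) * θ)
    set g := y D - ∑ i, c i * (v i ^ (D + 2)).im with hg
    have hg0 : 0 < g := by linarith
    -- The new point is `ε⁻¹ exp (iθ)`, and `ε` tends to `0` from above.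
    let u : ℝ → Fin D → ℝ := fun ε j => ε ^ (D - j.val) * Real.sin ((j.val + 2 : ℕ) * θ)
    let a : ℝ → Fin D → ℝ := fun ε => (imPowMatrix v)⁻¹.mulVec (u ε)
    let q : ℝ → ℝ := fun ε => s - ∑ i, a ε i * (v i ^ (D + 2)).im
    let c' : ℝ → Fin D → ℝ := fun ε i => c i - g / q ε * a ε i
    have hu0 : u 0 = 0 := by
      funext j
      have : D - j.val ≠ 0 := by omega
      simp [u, this]
    have ha0 : a 0 = 0 := by simp [a, hu0]
    have hq0 : q 0 = s := by simp [q, ha0]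
    have hu : Continuous u := by fun_prop
    have ha : Continuous a := Continuous.matrix_mulVec continuous_const hu
    have hai (i) : Continuous fun ε => a ε i := (continuous_apply i).comp ha
    have hq : Continuous q := by fun_prop
    have hgq : ContinuousAt (fun ε => g / q ε) 0 :=
      continuousAt_const.div hq.continuousAt (by rw [hq0]; exact hs.ne')
    have hc' (i) : ContinuousAt (fun ε => c' ε i) 0 :=
      continuousAt_const.sub (hgq.mul (hai i).continuousAt)
    have hnext : ContinuousAt (fun ε =>
        (∑ i, c' ε i * (v i ^ (D + 3)).im - y (D + 1)) * ε + g / q ε * s') 0 := by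
      refine ContinuousAt.add (ContinuousAt.mul (ContinuousAt.sub ?_ continuousAt_const)
        continuousAt_id) (hgq.mul continuousAt_const)
      exact tendsto_finsetSum _ fun i _ => (hc' i).mul continuousAt_const
    have ev1 : ∀ᶠ ε in nhds (0 : ℝ), 0 < q ε :=
      hq.continuousAt.eventually (lt_mem_nhds (by rw [hq0]; exact hs))
    have ev2 : ∀ᶠ ε in nhds (0 : ℝ), ∀ i, 0 < c' ε i :=
      Filter.eventually_all.2 fun i =>
        (hc' i).eventually (lt_mem_nhds (by simpa [c', ha0] using hc i))
    have ev3 : ∀ᶠ ε in nhds (0 : ℝ),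
        (∑ i, c' ε i * (v i ^ (D + 3)).im - y (D + 1)) * ε + g / q ε * s' < 0 := by
      refine hnext.eventually (gt_mem_nhds ?_)
      simp only [hq0, mul_zero, zero_add]
      exact mul_neg_of_pos_of_neg (div_pos hg0 hs) hs'
    obtain ⟨ε, ⟨⟨hqε, hcε⟩, hnε⟩, hε⟩ :=
      ((((ev1.and ev2).and ev3).filter_mono nhdsWithin_le_nhds).and
        (self_mem_nhdsWithin : Set.Ioi (0 : ℝ) ∈ nhdsWithin 0 (Set.Ioi 0))).exists
    replace hε : 0 < ε := hε
    have hAa : (imPowMatrix v).mulVec (a ε) = u ε := by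
      simp only [a]
      rw [Matrix.mulVec_mulVec, Matrix.mul_nonsing_inv _ (isUnit_iff_ne_zero.2 hdet),
        Matrix.one_mulVec]
    have hsum (j : ℕ) (hj : j < D) :
        ∑ i, a ε i * (v i ^ (j + 2)).im = ε ^ (D - j) * Real.sin ((j + 2 : ℕ) * θ) := by
      have := congrFun hAa ⟨j, hj⟩
      simp only [Matrix.mulVec, dotProduct, imPowMatrix, Matrix.of_apply, u] at this
      rw [← this]
      exact Finset.sum_congr rfl fun i _ => mul_comm _ _
    set w : ℂ := ((ε⁻¹ : ℝ) : ℂ) * exp (θ * I) with hw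
    have hwim (k : ℕ) : (w ^ k).im = (ε⁻¹) ^ k * Real.sin (k * θ) := im_ofReal_mul_exp_pow _ _ _
    have hwlow (j : ℕ) (hj : j ≤ D) :
        ε ^ (D + 2) * (w ^ (j + 2)).im = ε ^ (D - j) * Real.sin ((j + 2 : ℕ) * θ) := by
      have : D + 2 = (D - j) + (j + 2) := by omega
      rw [hwim, this, pow_add, inv_pow]
      field_simp
    have hwtop : ε ^ (D + 2) * (w ^ (D + 2)).im = s := by
      rw [hwlow D le_rfl, Nat.sub_self, pow_zero, one_mul]
    have hwnext : ε ^ (D + 2) * (w ^ (D + 3)).im = ε⁻¹ * s' := by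
      rw [hwim, inv_pow, pow_succ ε (D + 2)]
      field_simp
      rfl
    have hlin (k : ℕ) : ∑ i, c' ε i * (v i ^ k).im =
        ∑ i, c i * (v i ^ k).im - g / q ε * ∑ i, a ε i * (v i ^ k).im := by
      simp only [c', sub_mul, Finset.sum_sub_distrib, Finset.mul_sum, mul_assoc]
    have hqdef : ∑ i, a ε i * (v i ^ (D + 2)).im = s - q ε := by simp [q]
    refine ⟨Fin.snoc (c' ε) (g / q ε * ε ^ (D + 2)), Fin.snoc v w, ?_, ?_, ?_, ?_, ?_⟩
    · intro i
      refine Fin.lastCases ?_ (fun i => ?_) i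
      · simp only [Fin.snoc_last]
        positivity
      · simpa using hcε i
    · intro i
      refine Fin.lastCases ?_ (fun i => ?_) i
      · simp only [Fin.snoc_last, hw, re_ofReal_mul, im_ofReal_mul, exp_ofReal_mul_I_re,
          exp_ofReal_mul_I_im]
        exact ⟨mul_neg_of_pos_of_neg (by positivity) hcos,
          mul_neg_of_pos_of_neg (by positivity) hsin⟩
      · simpa using hv i
    · intro h0
      obtain ⟨x, hx, hx0⟩ := Matrix.exists_mulVec_eq_zero_iff.2 h0
      set t := x (Fin.last D)
      have hrow (j : ℕ) (hj : j < D + 1) :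
          ∑ i : Fin D, x i.castSucc * (v i ^ (j + 2)).im + t * (w ^ (j + 2)).im = 0 := by
        have := congrFun hx0 ⟨j, hj⟩
        simp only [Matrix.mulVec, dotProduct, imPowMatrix, Matrix.of_apply,
          Fin.sum_univ_castSucc, Fin.snoc_castSucc, Fin.snoc_last, Pi.zero_apply] at this
        rw [← this]
        simp only [mul_comm, t]
      -- Eliminating the new coordinate `t` leaves a vector in the kernel of the old matrix.
      have hker : (imPowMatrix v).mulVec
          (fun i => ε ^ (D + 2) * x i.castSucc + t * a ε i) = 0 := by
        funext j
        have h1 := hrow j.val (by omega)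
        have h2 := hsum j.val j.isLt
        have h3 := hwlow j.val j.isLt.le
        simp only [Matrix.mulVec, dotProduct, imPowMatrix, Matrix.of_apply, Pi.zero_apply]
        have : ∑ i, (v i ^ (j.val + 2)).im * (ε ^ (D + 2) * x i.castSucc + t * a ε i) =
            ε ^ (D + 2) * ∑ i, x i.castSucc * (v i ^ (j.val + 2)).im +
              t * ∑ i, a ε i * (v i ^ (j.val + 2)).im := by
          rw [Finset.mul_sum, Finset.mul_sum, ← Finset.sum_add_distrib]
          exact Finset.sum_congr rfl fun i _ => by ring
        rw [this, h2, ← h3]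
        linear_combination ε ^ (D + 2) * h1
      have hxa (i : Fin D) : ε ^ (D + 2) * x i.castSucc = -(t * a ε i) := by
        have := congrFun (Matrix.eq_zero_of_mulVec_eq_zero hdet hker) i
        simp only [Pi.zero_apply] at this
        linarith
      have hlastrow := hrow D (by omega)
      have hS : ε ^ (D + 2) * ∑ i : Fin D, x i.castSucc * (v i ^ (D + 2)).im =
          -(t * (s - q ε)) := by
        rw [← hqdef, Finset.mul_sum, Finset.mul_sum, ← Finset.sum_neg_distrib]
        refine Finset.sum_congr rfl fun i _ => ?_
        linear_combination (v i ^ (D + 2)).im * hxa i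
      have ht : t * q ε = 0 := by
        linear_combination ε ^ (D + 2) * hlastrow - hS - t * hwtop
      have ht0 : t = 0 := (mul_eq_zero.1 ht).resolve_right hqε.ne'
      refine hx (funext fun i => Fin.lastCases ht0 (fun i => ?_) i)
      have := hxa i
      rw [ht0, zero_mul, neg_zero] at this
      exact (mul_eq_zero.1 this).resolve_left (by positivity)
    · intro j hj
      simp only [Fin.sum_univ_castSucc, Fin.snoc_castSucc, Fin.snoc_last]
      rcases Nat.lt_succ_iff_lt_or_eq.1 hj with hj | rfl
      · rw [hlin, hmom j hj, hsum j hj, ← hwlow j hj.le]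
        ring
      · rw [hlin, hqdef, mul_assoc, hwtop]
        have : g / q ε * q ε = g := div_mul_cancel₀ _ hqε.ne'
        linear_combination this + hg
    · simp only [Fin.sum_univ_castSucc, Fin.snoc_castSucc, Fin.snoc_last]
      rw [show D + 1 + 2 = D + 3 from rfl, mul_assoc, hwnext]
      have : g / q ε * (ε⁻¹ * s') = (g / q ε * s') / ε := by ring
      rw [this, ← lt_sub_iff_add_lt', div_lt_iff₀ hε]
      linarith

lemma injective_of_det_imPowMatrix_ne_zero {D : ℕ} {v : Fin D → ℂ}
    (h : (imPowMatrix v).det ≠ 0) : Function.Injective v := by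
  intro i j hij
  by_contra hne
  exact h (Matrix.det_zero_of_column_eq hne fun k => by simp [imPowMatrix, hij])

lemma neg_one_pow_mul_im_pow_even (v : ℂ) (k : ℕ) :
    (-1 : ℝ) ^ (k + 1) * ((-I * (starRingEnd ℂ) v) ^ (2 * k)).im = (v ^ (2 * k)).im := by
  have h : (-I * (starRingEnd ℂ) v) ^ (2 * k) =
      (((-1 : ℝ) ^ k : ℝ) : ℂ) * (starRingEnd ℂ) (v ^ (2 * k)) := by
    rw [mul_pow, pow_mul (-I), neg_sq, I_sq, map_pow]
    push_cast
    rfl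
  have h2 : (-1 : ℝ) ^ k * (-1) ^ k = 1 := by rw [← mul_pow]; simp
  rw [h, im_ofReal_mul, conj_im]
  linear_combination (v ^ (2 * k)).im * h2

lemma neg_one_pow_mul_re_pow_odd (v : ℂ) (k : ℕ) :
    (-1 : ℝ) ^ (k + 1) * ((-I * (starRingEnd ℂ) v) ^ (2 * k + 1)).re = (v ^ (2 * k + 1)).im := by
  have h : (-I * (starRingEnd ℂ) v) ^ (2 * k + 1) =
      (((-1 : ℝ) ^ k : ℝ) : ℂ) * (-I * (starRingEnd ℂ) (v ^ (2 * k + 1))) := by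
    rw [mul_pow, pow_succ (-I), pow_mul (-I), neg_sq, I_sq, map_pow]
    push_cast
    ring
  have h2 : (-1 : ℝ) ^ k * (-1) ^ k = 1 := by rw [← mul_pow]; simp
  rw [h, re_ofReal_mul, neg_mul, neg_re, I_mul_re, conj_im]
  linear_combination (v ^ (2 * k + 1)).im * h2

/-- **Discrete truncated moment problem, odd case.** For every `n ≥ 1` there exist
positive weights `c₁, …, c_{2n+2}` and pairwise distinct points `z₁, …, z_{2n+2}` in the
open first quadrant such that `(−1)^{k+1} Im Σ c_i z_i^{2k} = 2k` and
`(−1)^{k+1} Re Σ c_i z_i^{2k+1} = 2k+1` for `1 ≤ k ≤ n`, and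
`(−1)^n Im Σ c_i z_i^{2(n+1)} < 2(n+1)`. -/
theorem discrete_moment_problem_odd (n : ℕ) (hn : 1 ≤ n) :
    ∃ (c : Fin (2 * n + 2) → ℝ) (z : Fin (2 * n + 2) → ℂ),
      (∀ i, 0 < c i) ∧ Function.Injective z ∧
      (∀ i, 0 < (z i).re ∧ 0 < (z i).im) ∧
      (∀ k : ℕ, 1 ≤ k → k ≤ n →
        (-1 : ℝ) ^ (k + 1) * (∑ i, (c i : ℂ) * z i ^ (2 * k)).im = 2 * k ∧
        (-1 : ℝ) ^ (k + 1) * (∑ i, (c i : ℂ) * z i ^ (2 * k + 1)).re = 2 * k + 1) ∧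
      (-1 : ℝ) ^ n * (∑ i, (c i : ℂ) * z i ^ (2 * (n + 1))).im < 2 * (n + 1) := by
  let y : ℕ → ℝ := fun j => if j = 2 * n then 2 * n + 1 else j + 2
  obtain ⟨c, v, hc, hv, hdet, hmom, -⟩ := exists_third_quadrant_moments y
    (by simp [y]; split_ifs <;> positivity) (2 * n + 2)
  have heven (k : ℕ) : (-1 : ℝ) ^ (k + 1) *
      (∑ i, (c i : ℂ) * (-I * (starRingEnd ℂ) (v i)) ^ (2 * k)).im =
        ∑ i, c i * (v i ^ (2 * k)).im := by
    simp only [im_sum, im_ofReal_mul, Finset.mul_sum]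
    refine Finset.sum_congr rfl fun i _ => ?_
    rw [mul_left_comm, neg_one_pow_mul_im_pow_even]
  have hodd (k : ℕ) : (-1 : ℝ) ^ (k + 1) *
      (∑ i, (c i : ℂ) * (-I * (starRingEnd ℂ) (v i)) ^ (2 * k + 1)).re =
        ∑ i, c i * (v i ^ (2 * k + 1)).im := by
    simp only [re_sum, re_ofReal_mul, Finset.mul_sum]
    refine Finset.sum_congr rfl fun i _ => ?_
    rw [mul_left_comm, neg_one_pow_mul_re_pow_odd]
  refine ⟨c, fun i => -I * (starRingEnd ℂ) (v i), hc, fun i j hij => ?_, fun i => ?_,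
    fun k hk hkn => ⟨?_, ?_⟩, ?_⟩
  · apply injective_of_det_imPowMatrix_ne_zero hdet
    exact (starRingEnd ℂ).injective (by simpa using hij)
  · simpa using (hv i).symm
  · obtain ⟨k, rfl⟩ := Nat.exists_eq_add_of_le' hk
    rw [heven]
    refine (hmom (2 * k) (by omega)).trans ?_
    simp only [y]
    rw [if_neg (by omega)]
    push_cast
    ring
  · obtain ⟨k, rfl⟩ := Nat.exists_eq_add_of_le' hk
    rw [hodd]
    refine (hmom (2 * k + 1) (by omega)).trans ?_
    simp only [y]
    rw [if_neg (by omega)]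
    push_cast
    ring
  · have h := heven (n + 1)
    rw [show (-1 : ℝ) ^ (n + 1 + 1) = (-1) ^ n by ring] at h
    rw [h]
    refine (hmom (2 * n) (by omega)).trans_lt ?_
    simp only [y, if_true]
    linarith
end
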